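/- arXiv:1912.07216 — 3 statements merged into one kernel-verified Lean document; each statement's English description precedes it below -/
import Mathlib

section
/- Let L be a λ-graph bisystem over a finite alphabet Σ satisfying FPCC. The source and range maps s, r : R_L → X_L, defined by s(x,z) = z and r(x,z) = x, are local homeomorphisms with respect to the inductive limit topology on R_L; hence the equivalence relation R_L is étale. -/
/-! ## λ-graph bisystems -/

structure LambdaGraphBisystem (A : Type) where
  V : ℕ → Type
  Em : ℕ → Type
  Ep : ℕ → Type
  fintypeV : ∀ l, Fintype (V l)
  nonemptyV : ∀ l, Nonempty (V l)
  fintypeEm : ∀ l, Fintype (Em l)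
  fintypeEp : ∀ l, Fintype (Ep l)
  sm : ∀ l, Em l → V (l + 1)
  tm : ∀ l, Em l → V l
  lm : ∀ l, Em l → A
  sp : ∀ l, Ep l → V l
  tp : ∀ l, Ep l → V (l + 1)
  lp : ∀ l, Ep l → A

namespace LambdaGraphBisystem

variable {A : Type}

/-- The follower sets `F(v)`: label words of downward paths in `L⁻` starting at `v`,
labels read in reverse edge order. -/
def Fset (L : LambdaGraphBisystem A) : ∀ l, L.V l → Set (List A)
  | 0, _ => {[]}
  | l + 1, v =>
    {w | ∃ e : L.Em l, L.sm l e = v ∧ ∃ w' ∈ L.Fset l (L.tm l e), w = L.lm l e :: w'}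

/-- The predecessor sets `P(v)`: label words of upward paths in `L⁺` ending at `v`. -/
def Pset (L : LambdaGraphBisystem A) : ∀ l, L.V l → Set (List A)
  | 0, _ => {[]}
  | l + 1, v =>
    {w | ∃ e : L.Ep l, L.tp l e = v ∧ ∃ w' ∈ L.Pset l (L.sp l e), w = w' ++ [L.lp l e]}

end LambdaGraphBisystem

/-- The axioms making a pair of labeled Bratteli diagrams a λ-graph bisystem
satisfying FPCC. -/
structure IsLGBS {A : Type} (L : LambdaGraphBisystem A) : Prop where
  subsingletonV0 : Subsingleton (L.V 0)
  rightResolving : ∀ l (e f : L.Em l), L.sm l e = L.sm l f → L.lm l e = L.lm l f → e = f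
  leftResolving : ∀ l (e f : L.Ep l), L.tp l e = L.tp l f → L.lp l e = L.lp l f → e = f
  localProperty : ∀ (l : ℕ) (u : L.V l) (v : L.V (l + 2)),
    ∃ φ : {fp : L.Ep l × L.Em (l + 1) //
            L.sp l fp.1 = u ∧ L.tp l fp.1 = L.tm (l + 1) fp.2 ∧ L.sm (l + 1) fp.2 = v} ≃
          {ee : L.Em l × L.Ep (l + 1) //
            L.tm l ee.1 = u ∧ L.sm l ee.1 = L.sp (l + 1) ee.2 ∧ L.tp (l + 1) ee.2 = v},
      ∀ fp, L.lp l fp.val.1 = L.lp (l + 1) (φ fp).val.2 ∧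
            L.lm (l + 1) fp.val.2 = L.lm l (φ fp).val.1
  fpcc : ∀ l (v : L.V l), L.Fset l v = L.Pset l v

variable {A : Type}

/-! ## The configuration space.

A configuration is indexed here by coordinates `(k, n)` where `k : ℤ` is the row and
`n : ℕ` is the level; the pair `(k, n)` corresponds to the position `(k, l)` of the paper
with `l = k + n + 1` (so `n = n(k,l) = l - k - 1`).  `v k n` is the vertex `v_{(k,l)}`,
`em k n` is the edge `e⁻_{(k-1,k),l} ∈ E⁻_{n(k-1,l),n(k,l)}` and `ep k n` is the edge
`e⁺_{k,(l,l+1)} ∈ E⁺_{n(k,l),n(k,l+1)}`. -/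

structure Config {A : Type} (L : LambdaGraphBisystem A) where
  v : ℤ → ∀ n : ℕ, L.V n
  em : ℤ → ∀ n : ℕ, L.Em n
  ep : ℤ → ∀ n : ℕ, L.Ep n
  em_s : ∀ (k : ℤ) (n : ℕ), L.sm n (em k n) = v (k - 1) (n + 1)
  em_t : ∀ (k : ℤ) (n : ℕ), L.tm n (em k n) = v k n
  ep_s : ∀ (k : ℤ) (n : ℕ), L.sp n (ep k n) = v k n
  ep_t : ∀ (k : ℤ) (n : ℕ), L.tp n (ep k n) = v k (n + 1)
  label : ∃ xs : ℤ → A, (∀ (k : ℤ) (n : ℕ), L.lm n (em k n) = xs k) ∧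
    (∀ (k : ℤ) (n : ℕ), L.lp n (ep k n) = xs (k + n + 1))

theorem Config.v_congr {L : LambdaGraphBisystem A} (x : Config L) {a b : ℤ} (n : ℕ)
    (h : a = b) : x.v a n = x.v b n := by rw [h]

/-- The word `P_x(v_{(p,q)})` of `λ⁺`-labels along row `p`, of length `n = q - p - 1`. -/
def Pword {L : LambdaGraphBisystem A} (x : Config L) (p : ℤ) : ℕ → List A
  | 0 => []
  | n + 1 => Pword x p n ++ [L.lp n (x.ep p n)]

/-- The cylinder set `U_{(μ; v)}` for a vertex `v` at position `(p, p + n + 1)`. -/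
def Cyl {L : LambdaGraphBisystem A} (p : ℤ) (n : ℕ) (v : L.V n) (μ : List A) :
    Set (Config L) :=
  {x | x.v p n = v ∧ Pword x p n = μ}

def cylinderSets (L : LambdaGraphBisystem A) : Set (Set (Config L)) :=
  {U | ∃ (p : ℤ) (n : ℕ) (v : L.V n) (μ : List A), μ ∈ L.Pset n v ∧ U = Cyl p n v μ}

/-- The topology on the configuration space generated by the cylinder sets. -/
def configTop (L : LambdaGraphBisystem A) : TopologicalSpace (Config L) :=
  TopologicalSpace.generateFrom (cylinderSets L)

instance (L : LambdaGraphBisystem A) : TopologicalSpace (Config L) := configTop L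
/-! ## Triangles and the metric -/

/-- Equality of the `(p,q)`-triangles `△_{(p,q)}(x) = △_{(p,q)}(z)`:
the restrictions of the two configurations to `{(k,l) : p ≤ k < l ≤ q}` coincide. -/
def TriEq {L : LambdaGraphBisystem A} (x z : Config L) (p q : ℤ) : Prop :=
  (∀ (k : ℤ) (n : ℕ), p ≤ k → k + n + 1 ≤ q → x.v k n = z.v k n) ∧
  (∀ (k : ℤ) (n : ℕ), p + 1 ≤ k → k + n + 1 ≤ q → x.em k n = z.em k n) ∧
  (∀ (k : ℤ) (n : ℕ), p ≤ k → k + n + 2 ≤ q → x.ep k n = z.ep k n)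

open scoped Classical in
/-- The metric on `X_L` defined from agreement of central triangles:
`d(x,z) ≤ 1/2^p` iff `△_{(-p,p)}(x) = △_{(-p,p)}(z)`. -/
noncomputable def configDist {L : LambdaGraphBisystem A} (x z : Config L) : ℝ :=
  ⨅ p : ℕ, if TriEq x z (-(p : ℤ)) (p : ℤ) then ((1 : ℝ) / 2) ^ p else 1

/-! ## Standalone (p,q)-triangles -/

structure Triangle {A : Type} (L : LambdaGraphBisystem A) (p q : ℤ) where
  v : ∀ (k : ℤ) (n : ℕ), p ≤ k → k + n + 1 ≤ q → L.V n
  em : ∀ (k : ℤ) (n : ℕ), p + 1 ≤ k → k + n + 1 ≤ q → L.Em n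
  ep : ∀ (k : ℤ) (n : ℕ), p ≤ k → k + n + 2 ≤ q → L.Ep n
  em_s : ∀ (k : ℤ) (n : ℕ) (h : p + 1 ≤ k) (h' : k + n + 1 ≤ q),
    L.sm n (em k n h h') = v (k - 1) (n + 1) (by omega) (by omega)
  em_t : ∀ (k : ℤ) (n : ℕ) (h : p + 1 ≤ k) (h' : k + n + 1 ≤ q),
    L.tm n (em k n h h') = v k n (by omega) h'
  ep_s : ∀ (k : ℤ) (n : ℕ) (h : p ≤ k) (h' : k + n + 2 ≤ q),
    L.sp n (ep k n h h') = v k n h (by omega)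
  ep_t : ∀ (k : ℤ) (n : ℕ) (h : p ≤ k) (h' : k + n + 2 ≤ q),
    L.tp n (ep k n h h') = v k (n + 1) h (by omega)
  label : ∃ xs : ℤ → A,
    (∀ (k : ℤ) (n : ℕ) (h : p + 1 ≤ k) (h' : k + n + 1 ≤ q), L.lm n (em k n h h') = xs k) ∧
    (∀ (k : ℤ) (n : ℕ) (h : p ≤ k) (h' : k + n + 2 ≤ q), L.lp n (ep k n h h') = xs (k + n + 1))

/-- The `λ⁺`-label word along the bottom row of a `(p,q)`-triangle. -/
def Triangle.word {L : LambdaGraphBisystem A} {p q : ℤ} (T : Triangle L p q) :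
    ∀ n : ℕ, p + n + 1 ≤ q → List A
  | 0, _ => []
  | n + 1, h => T.word n (by omega) ++ [L.lp n (T.ep p n le_rfl (by omega))]

/-! ## (p,q)-rectangles -/

structure Rect {A : Type} (L : LambdaGraphBisystem A) (p q : ℤ) where
  v : ∀ (k : ℤ) (n : ℕ), k ≤ p → q ≤ k + n + 1 → L.V n
  em : ∀ (k : ℤ) (n : ℕ), k ≤ p → q ≤ k + n + 1 → L.Em n
  ep : ∀ (k : ℤ) (n : ℕ), k ≤ p → q ≤ k + n + 1 → L.Ep n
  em_s : ∀ (k : ℤ) (n : ℕ) (h : k ≤ p) (h' : q ≤ k + n + 1),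
    L.sm n (em k n h h') = v (k - 1) (n + 1) (by omega) (by omega)
  em_t : ∀ (k : ℤ) (n : ℕ) (h : k ≤ p) (h' : q ≤ k + n + 1),
    L.tm n (em k n h h') = v k n h h'
  ep_s : ∀ (k : ℤ) (n : ℕ) (h : k ≤ p) (h' : q ≤ k + n + 1),
    L.sp n (ep k n h h') = v k n h h'
  ep_t : ∀ (k : ℤ) (n : ℕ) (h : k ≤ p) (h' : q ≤ k + n + 1),
    L.tp n (ep k n h h') = v k (n + 1) h (by omega)
  label : ∃ xs : ℤ → A,
    (∀ (k : ℤ) (n : ℕ) (h : k ≤ p) (h' : q ≤ k + n + 1), L.lm n (em k n h h') = xs k) ∧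
    (∀ (k : ℤ) (n : ℕ) (h : k ≤ p) (h' : q ≤ k + n + 1), L.lp n (ep k n h h') = xs (k + n + 1))

theorem Rect.v_congr {L : LambdaGraphBisystem A} {p q : ℤ} (R : Rect L p q) {a b : ℤ}
    (n : ℕ) (h : a = b) {h1 : a ≤ p} {h2 : q ≤ a + n + 1} {h3 : b ≤ p} {h4 : q ≤ b + n + 1} :
    R.v a n h1 h2 = R.v b n h3 h4 := by subst h; rfl

/-- The `(p,q)`-rectangle `□_{(p,q)}(x)` of a configuration `x`. -/
def Config.toRect {L : LambdaGraphBisystem A} (x : Config L) (p q : ℤ) : Rect L p q where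
  v k n _ _ := x.v k n
  em k n _ _ := x.em k n
  ep k n _ _ := x.ep k n
  em_s k n _ _ := x.em_s k n
  em_t k n _ _ := x.em_t k n
  ep_s k n _ _ := x.ep_s k n
  ep_t k n _ _ := x.ep_t k n
  label := by
    obtain ⟨xs, h1, h2⟩ := x.label
    exact ⟨xs, fun k n _ _ => h1 k n, fun k n _ _ => h2 k n⟩

/-- The upper left corner vertex of a `(p,q)`-rectangle. -/
def Rect.corner {L : LambdaGraphBisystem A} {p q : ℤ} (R : Rect L p q) (n₀ : ℕ)
    (hn : (n₀ : ℤ) = q - p - 1) : L.V n₀ :=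
  R.v p n₀ le_rfl (by omega)

/-! ## Zigzag paths -/

/-- A zigzag path starting from a vertex `v ∈ V_{(p,q)}`, `n₀ = n(p,q)`:
`ep k` is `e⁺_{p-k,(q+k,q+k+1)}` and `em k` is `e⁻_{(p-k-1,p-k),q+k+1}`. -/
structure Zigzag {A : Type} (L : LambdaGraphBisystem A) (n₀ : ℕ) (v : L.V n₀) where
  ep : ∀ k : ℕ, L.Ep (n₀ + 2 * k)
  em : ∀ k : ℕ, L.Em (n₀ + 2 * k + 1)
  start : L.sp n₀ (ep 0) = v
  turn1 : ∀ k : ℕ, L.tp (n₀ + 2 * k) (ep k) = L.tm (n₀ + 2 * k + 1) (em k)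
  turn2 : ∀ k : ℕ, L.sm (n₀ + 2 * k + 1) (em k) = L.sp (n₀ + 2 * k + 2) (ep (k + 1))

/-- The vertex `v_{(p-k, q+k)}` visited by a zigzag path. -/
def Zigzag.vert {L : LambdaGraphBisystem A} {n₀ : ℕ} {v : L.V n₀} (γ : Zigzag L n₀ v)
    (k : ℕ) : L.V (n₀ + 2 * k) := L.sp (n₀ + 2 * k) (γ.ep k)

/-- The vertex `v_{(p-k, q+k+1)}` visited by a zigzag path. -/
def Zigzag.vert' {L : LambdaGraphBisystem A} {n₀ : ℕ} {v : L.V n₀} (γ : Zigzag L n₀ v)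
    (k : ℕ) : L.V (n₀ + 2 * k + 1) := L.tp (n₀ + 2 * k) (γ.ep k)

/-- The zigzag path obtained by restricting a `(p,q)`-rectangle. -/
def Rect.toZigzag {L : LambdaGraphBisystem A} {p q : ℤ} (R : Rect L p q) (n₀ : ℕ)
    (hn : (n₀ : ℤ) = q - p - 1) : Zigzag L n₀ (R.corner n₀ hn) where
  ep k := R.ep (p - k) (n₀ + 2 * k) (by omega) (by omega)
  em k := R.em (p - k) (n₀ + 2 * k + 1) (by omega) (by omega)
  start := (R.ep_s _ _ _ _).trans (R.v_congr _ (by simp))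
  turn1 k := (R.ep_t _ _ _ _).trans (R.em_t _ _ _ _).symm
  turn2 k := (R.em_s _ _ _ _).trans
    ((R.v_congr _ (by push_cast; ring)).trans (R.ep_s _ _ _ _).symm)
/-! ## Zigzag paths with head symbol -/

/-- The set `Z_L`: a zigzag path starting from a vertex of `V_1 = V_{(-1,1)}`
together with a head symbol `x₀`. -/
structure ZigzagHead {A : Type} (L : LambdaGraphBisystem A) where
  x0 : A
  v : L.V 1
  γ : Zigzag L 1 v
  head : ∃ e : L.Ep 0, L.lp 0 e = x0 ∧ L.tp 0 e = v

/-- Restriction of a configuration to its zigzag path with head symbol. -/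
def Config.toZigzagHead {L : LambdaGraphBisystem A} (x : Config L) : ZigzagHead L where
  x0 := L.lp 0 (x.ep (-1) 0)
  v := x.v (-1) 1
  γ :=
  { ep := fun k => x.ep (-1 - (k : ℤ)) (1 + 2 * k)
    em := fun k => x.em (-1 - (k : ℤ)) (1 + 2 * k + 1)
    start := (x.ep_s _ _).trans (x.v_congr _ (by simp))
    turn1 := fun k => (x.ep_t _ _).trans (x.em_t _ _).symm
    turn2 := fun k => (x.em_s _ _).trans
      ((x.v_congr _ (by push_cast; ring)).trans (x.ep_s _ _).symm) }
  head := ⟨x.ep (-1) 0, rfl, x.ep_t (-1) 0⟩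

/-- Condition (I): every vertex admits at least two zigzag paths starting from it. -/
def ConditionI (L : LambdaGraphBisystem A) : Prop :=
  ∀ (p q : ℤ), p < q → ∀ v : L.V (q - p - 1).toNat,
    ∃ γ₁ γ₂ : Zigzag L (q - p - 1).toNat v, γ₁ ≠ γ₂

/-! ## The AF-equivalence relation -/

/-- `□_{(p,q)}(x) = □_{(p,q)}(z)` : the restrictions of the two configurations to the
lower right infinite rectangle `{(k,l) : k ≤ p, q ≤ l}` coincide. -/
def RectEq {L : LambdaGraphBisystem A} (x z : Config L) (p q : ℤ) : Prop :=
  ∀ (k : ℤ) (n : ℕ), k ≤ p → q ≤ k + n + 1 →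
    x.v k n = z.v k n ∧ x.em k n = z.em k n ∧ x.ep k n = z.ep k n

/-- The relation `x ∼ z` on `X_L`. -/
def ConfigRel {L : LambdaGraphBisystem A} (x z : Config L) : Prop :=
  ∃ p q : ℤ, p < q ∧ RectEq x z p q

/-- The subequivalence relation `R_{L,(p,q)}` as a subset of `X_L × X_L`. -/
def RpqSet (L : LambdaGraphBisystem A) (p q : ℤ) : Set (Config L × Config L) :=
  {xz | RectEq xz.1 xz.2 p q}

/-- The equivalence relation `R_L` as a subset of `X_L × X_L`. -/
def Rset (L : LambdaGraphBisystem A) : Set (Config L × Config L) :=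
  {xz | ∃ p q : ℤ, p < q ∧ RectEq xz.1 xz.2 p q}

/-- The inclusion `R_{L,(p,q)} → R_L`. -/
def inclPQ (L : LambdaGraphBisystem A) (p q : ℤ) (h : p < q) (y : ↥(RpqSet L p q)) :
    ↥(Rset L) := ⟨y.val, ⟨p, q, h, y.prop⟩⟩

/-- The inductive limit topology on `R_L = ⋃ R_{L,(p,q)}`, where each `R_{L,(p,q)}`
carries the relative topology of `X_L × X_L`. -/
def indTop (L : LambdaGraphBisystem A) : TopologicalSpace ↥(Rset L) :=
  ⨆ (p : ℤ) (q : ℤ) (h : p < q),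
    TopologicalSpace.coinduced (inclPQ L p q h) inferInstance

/-! ## The shift -/

/-- The shift `σ_L^m` on the configuration space, `σ_L^m(x)_{(k,l)} = x_{(k+m,l+m)}`. -/
def shiftBy (L : LambdaGraphBisystem A) (m : ℤ) (x : Config L) : Config L where
  v k n := x.v (k + m) n
  em k n := x.em (k + m) n
  ep k n := x.ep (k + m) n
  em_s k n := (x.em_s (k + m) n).trans (x.v_congr (n + 1) (by ring))
  em_t k n := x.em_t (k + m) n
  ep_s k n := x.ep_s (k + m) n
  ep_t k n := x.ep_t (k + m) n
  label := by
    obtain ⟨xs, h1, h2⟩ := x.label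
    refine ⟨fun k => xs (k + m), fun k n => h1 (k + m) n, fun k n => (h2 (k + m) n).trans ?_⟩
    congr 1
    ring

/-- The label sequence `π(x) = (x_n)_{n ∈ ℤ}` of a configuration. -/
def configSeq {L : LambdaGraphBisystem A} (x : Config L) : ℤ → A :=
  fun k => L.lm 0 (x.em k 0)

/-! ## The groupoid `G_L = R_L ⋊ ℤ` -/

/-- `G_L = {(x,n,z) : (σ_L^n(x), z) ∈ R_L}`. -/
def GLset (L : LambdaGraphBisystem A) : Set (Config L × ℤ × Config L) :=
  {g | (shiftBy L g.2.1 g.1, g.2.2) ∈ Rset L}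

/-- The canonical bijection `(x,n,z) ↦ ((σ_L^n(x), z), n)` of `G_L` with `R_L × ℤ`. -/
def GLmap (L : LambdaGraphBisystem A) (g : ↥(GLset L)) : ↥(Rset L) × ℤ :=
  (⟨(shiftBy L g.val.2.1 g.val.1, g.val.2.2), g.prop⟩, g.val.2.1)

/-- The topology on `G_L` transported from `R_L × ℤ` (with `R_L` carrying the
inductive limit topology). -/
def GLtop (L : LambdaGraphBisystem A) : TopologicalSpace ↥(GLset L) :=
  TopologicalSpace.induced (GLmap L) (@instTopologicalSpaceProd _ _ (indTop L) _)

/-- `(X_L, σ_L)` is equivalently essentially free. -/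
def EquivEssFree (L : LambdaGraphBisystem A) : Prop :=
  ∀ n : ℤ, n ≠ 0 → interior {x : Config L | (shiftBy L n x, x) ∈ Rset L} = ∅

/-! ## Irreducibility -/

/-- Irreducibility of a λ-graph bisystem: every zigzag path `γ` from a vertex of
`V_1 = V_{(-1,1)}` is met by some zigzag path `η` from any prescribed vertex of
`V_{(-p,p)} = V_{2p-1}`; meeting means passing through the same vertex. -/
def IrreducibleLGBS (L : LambdaGraphBisystem A) : Prop :=
  ∀ p : ℕ, 1 ≤ p → ∀ (w : L.V (2 * p - 1)) (v : L.V 1) (γ : Zigzag L 1 v),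
    ∃ η : Zigzag L (2 * p - 1) w, ∃ k j : ℕ, 1 + 2 * k = 2 * p - 1 + 2 * j ∧
      (HEq (γ.vert k) (η.vert j) ∨ HEq (γ.vert' k) (η.vert' j))


/-! ## Helper material -/

namespace LHaux

def RM (L : LambdaGraphBisystem A) (n : ℕ) (v : L.V (n + 1)) (a : A) (u : L.V n) : Prop :=
  ∃ e : L.Em n, L.sm n e = v ∧ L.lm n e = a ∧ L.tm n e = u

def RP (L : LambdaGraphBisystem A) (n : ℕ) (v : L.V (n + 1)) (a : A) (u : L.V n) : Prop :=
  ∃ e : L.Ep n, L.tp n e = v ∧ L.lp n e = a ∧ L.sp n e = u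

theorem RM_unique {L : LambdaGraphBisystem A} (hL : IsLGBS L) {n : ℕ} {v : L.V (n + 1)} {a : A}
    {u u' : L.V n} (h : RM L n v a u) (h' : RM L n v a u') : u = u' := by
  obtain ⟨e, h1, h2, h3⟩ := h
  obtain ⟨e', h1', h2', h3'⟩ := h'
  have := hL.rightResolving n e e' (h1.trans h1'.symm) (h2.trans h2'.symm)
  rw [← h3, ← h3', this]

theorem RP_unique {L : LambdaGraphBisystem A} (hL : IsLGBS L) {n : ℕ} {v : L.V (n + 1)} {a : A}
    {u u' : L.V n} (h : RP L n v a u) (h' : RP L n v a u') : u = u' := by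
  obtain ⟨e, h1, h2, h3⟩ := h
  obtain ⟨e', h1', h2', h3'⟩ := h'
  have := hL.leftResolving n e e' (h1.trans h1'.symm) (h2.trans h2'.symm)
  rw [← h3, ← h3', this]

theorem square_M {L : LambdaGraphBisystem A} (hL : IsLGBS L) {n : ℕ} {t : L.V (n + 2)}
    {m w : L.V (n + 1)} {u : L.V n} {a b : A} (h1 : RM L (n + 1) t a m) (h2 : RP L n m b u)
    (h3 : RP L (n + 1) t b w) : RM L n w a u := by
  obtain ⟨e, e1, e2, e3⟩ := h1
  obtain ⟨f, f1, f2, f3⟩ := h2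
  obtain ⟨φ, hφ⟩ := hL.localProperty n u t
  have hh := hφ ⟨(f, e), f3, f1.trans e3.symm, e1⟩
  generalize φ ⟨(f, e), f3, f1.trans e3.symm, e1⟩ = y at hh
  obtain ⟨⟨g, k⟩, g1, g2, g3⟩ := y
  simp only at hh g1 g2 g3
  have : L.sp (n + 1) k = w := RP_unique hL ⟨k, g3, hh.1.symm.trans f2, rfl⟩ h3
  exact ⟨g, g2.trans this, hh.2.symm.trans e2, g1⟩

theorem square_P {L : LambdaGraphBisystem A} (hL : IsLGBS L) {n : ℕ} {t : L.V (n + 2)}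
    {m w : L.V (n + 1)} {u : L.V n} {a b : A} (h1 : RP L (n + 1) t b w) (h2 : RM L n w a u)
    (h3 : RM L (n + 1) t a m) : RP L n m b u := by
  obtain ⟨e, e1, e2, e3⟩ := h1
  obtain ⟨f, f1, f2, f3⟩ := h2
  obtain ⟨φ, hφ⟩ := hL.localProperty n u t
  have hh := hφ (φ.symm ⟨(f, e), f3, f1.trans e3.symm, e1⟩)
  rw [Equiv.apply_symm_apply] at hh
  generalize φ.symm ⟨(f, e), f3, f1.trans e3.symm, e1⟩ = y at hh
  obtain ⟨⟨g, k⟩, g1, g2, g3⟩ := y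
  simp only at hh g1 g2 g3
  have : L.tm (n + 1) k = m := RM_unique hL ⟨k, g3, hh.2.trans f2, rfl⟩ h3
  exact ⟨g, g2.trans this, hh.1.trans e2, g1⟩

/-! words -/

def word (xs : ℤ → A) (k : ℤ) : ℕ → List A
  | 0 => []
  | n + 1 => word xs k n ++ [xs (k + n + 1)]

theorem word_cons (xs : ℤ → A) (k : ℤ) (n : ℕ) :
    word xs k (n + 1) = xs (k + 1) :: word xs (k + 1) n := by
  induction n with
  | zero => simp [word]
  | succ n ih =>
    rw [word, ih, word]
    simp only [List.cons_append]
    congr 4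
    push_cast; ring

theorem word_eq_iff (xs ys : ℤ → A) (k : ℤ) (n : ℕ) :
    word xs k n = word ys k n ↔ ∀ j, k < j → j ≤ k + n → xs j = ys j := by
  induction n with
  | zero => simp only [word, true_iff]; intro j h1 h2; simp at h2; omega
  | succ n ih =>
    simp only [word]
    constructor
    · intro h j h1 h2
      obtain ⟨e1, e2⟩ := List.append_inj' h rfl
      simp only [List.cons.injEq, and_true] at e2
      by_cases hj : j ≤ k + n
      · exact ih.1 e1 j h1 hj
      · have : j = k + n + 1 := by push_cast at h2; omega
        rw [this, e2]
    · intro h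
      rw [ih.2 fun j h1 h2 => h j h1 (by push_cast; omega),
        h (k + n + 1) (by omega) (by push_cast; omega)]

def Good (L : LambdaGraphBisystem A) (xs : ℤ → A) (k : ℤ) (n : ℕ) (v : L.V n) : Prop :=
  word xs k n ∈ L.Pset n v

theorem good_P {L : LambdaGraphBisystem A} {xs : ℤ → A} {k : ℤ} {n : ℕ}
    {v : L.V (n + 1)} (h : Good L xs k (n + 1) v) :
    ∃ u, RP L n v (xs (k + n + 1)) u ∧ Good L xs k n u := by
  obtain ⟨e, he, w', hw', hw⟩ := h
  rw [word] at hw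
  obtain ⟨h1, h2⟩ := List.append_inj' hw rfl
  simp at h2
  exact ⟨_, ⟨e, he, h2.symm, rfl⟩, by rw [Good, h1]; exact hw'⟩

theorem good_M {L : LambdaGraphBisystem A} (hL : IsLGBS L) {xs : ℤ → A} {k : ℤ} {n : ℕ}
    {v : L.V (n + 1)} (h : Good L xs k (n + 1) v) :
    ∃ u, RM L n v (xs (k + 1)) u ∧ Good L xs (k + 1) n u := by
  rw [Good, ← hL.fpcc, word_cons] at h
  obtain ⟨e, he, w', hw', hw⟩ := h
  simp only [List.cons.injEq] at hw
  exact ⟨_, ⟨e, he, hw.1.symm, rfl⟩, by rw [Good, hw.2, ← hL.fpcc]; exact hw'⟩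

theorem good_of_P {L : LambdaGraphBisystem A} {xs : ℤ → A} {k : ℤ} {n : ℕ}
    {v : L.V (n + 1)} {u} (h : RP L n v (xs (k + n + 1)) u) (hu : Good L xs k n u) :
    Good L xs k (n + 1) v := by
  obtain ⟨e, h1, h2, h3⟩ := h
  subst h3
  exact ⟨e, h1, _, hu, by rw [word, h2]⟩

theorem good_of_M {L : LambdaGraphBisystem A} (hL : IsLGBS L) {xs : ℤ → A} {k : ℤ} {n : ℕ}
    {v : L.V (n + 1)} {u} (h : RM L n v (xs (k + 1)) u) (hu : Good L xs (k + 1) n u) :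
    Good L xs k (n + 1) v := by
  obtain ⟨e, h1, h2, h3⟩ := h
  subst h3
  rw [Good, ← hL.fpcc] at hu ⊢
  exact ⟨e, h1, _, hu, by rw [word_cons, h2]⟩

/-! labels of configurations -/

theorem lm_lab {L : LambdaGraphBisystem A} (x : Config L) (k : ℤ) (n : ℕ) :
    L.lm n (x.em k n) = configSeq x k := by
  obtain ⟨xs, h1, h2⟩ := x.label
  rw [configSeq, h1, h1]

theorem lp_lab {L : LambdaGraphBisystem A} (x : Config L) (k : ℤ) (n : ℕ) :
    L.lp n (x.ep k n) = configSeq x (k + n + 1) := by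
  obtain ⟨xs, h1, h2⟩ := x.label
  rw [configSeq, h1, h2]

theorem rM {L : LambdaGraphBisystem A} (x : Config L) (k : ℤ) (n : ℕ) :
    RM L n (x.v (k - 1) (n + 1)) (configSeq x k) (x.v k n) :=
  ⟨x.em k n, x.em_s k n, lm_lab x k n, x.em_t k n⟩

theorem rP {L : LambdaGraphBisystem A} (x : Config L) (k : ℤ) (n : ℕ) :
    RP L n (x.v k (n + 1)) (configSeq x (k + n + 1)) (x.v k n) :=
  ⟨x.ep k n, x.ep_t k n, lp_lab x k n, x.ep_s k n⟩

theorem Pword_eq {L : LambdaGraphBisystem A} (x : Config L) (k : ℤ) (n : ℕ) :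
    Pword x k n = word (configSeq x) k n := by
  induction n with
  | zero => rfl
  | succ n ih => rw [Pword, word, ih, lp_lab]

theorem good_config {L : LambdaGraphBisystem A} (x : Config L) (k : ℤ) (n : ℕ) :
    Good L (configSeq x) k n (x.v k n) := by
  induction n with
  | zero => simp [Good, word, LambdaGraphBisystem.Pset]
  | succ n ih => exact good_of_P (rP x k n) ih

/-! descent -/

theorem descP {L : LambdaGraphBisystem A} (hL : IsLGBS L) (x z : Config L) (k : ℤ) (n m : ℕ)
    (hv : x.v k (n + m) = z.v k (n + m))
    (hl : ∀ j, k + n + 1 ≤ j → j ≤ k + n + m → configSeq x j = configSeq z j) :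
    x.v k n = z.v k n := by
  induction m with
  | zero => exact hv
  | succ m ih =>
    apply ih
    · have h1 := rP x k (n + m)
      have h2 := rP z k (n + m)
      have e : configSeq x (k + ↑(n + m) + 1) = configSeq z (k + ↑(n + m) + 1) :=
        hl _ (by push_cast; omega) (by push_cast; omega)
      have hv' : x.v k (n + m + 1) = z.v k (n + m + 1) := hv
      rw [hv', e] at h1
      exact RP_unique hL h1 h2
    · intro j h1 h2
      exact hl j h1 (by push_cast; omega)

theorem descM {L : LambdaGraphBisystem A} (hL : IsLGBS L) (x z : Config L) (m : ℕ) :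
    ∀ (k : ℤ) (n : ℕ), x.v (k - m) (n + m) = z.v (k - m) (n + m) →
    (∀ j, k - m < j → j ≤ k → configSeq x j = configSeq z j) →
    x.v k n = z.v k n := by
  induction m with
  | zero => intro k n hv _; simpa using hv
  | succ m ih =>
    intro k n hv hl
    have hv' : x.v (k - 1) (n + 1) = z.v (k - 1) (n + 1) := by
      apply ih
      · have e1 : (k - 1 - (m : ℤ)) = k - ((m + 1 : ℕ) : ℤ) := by push_cast; ring
        have e2 : n + 1 + m = n + (m + 1) := by omega
        rw [e1, e2]; exact hv
      · intro j h1 h2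
        exact hl j (by push_cast; omega) (by omega)
    have h1 := rM x k n
    rw [hv', hl k (by push_cast; omega) le_rfl] at h1
    exact RM_unique hL h1 (rM z k n)

theorem desc {L : LambdaGraphBisystem A} (hL : IsLGBS L) (x z : Config L) (k' : ℤ) (n' : ℕ)
    (hv : x.v k' n' = z.v k' n') (k : ℤ) (n : ℕ) (hk : k' ≤ k) (hl : k + n ≤ k' + n')
    (h1 : ∀ j, k' < j → j ≤ k → configSeq x j = configSeq z j)
    (h2 : ∀ j, k + n + 1 ≤ j → j ≤ k' + n' → configSeq x j = configSeq z j) :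
    x.v k n = z.v k n := by
  obtain ⟨i, rfl⟩ : ∃ i : ℕ, k = k' + i := ⟨(k - k').toNat, by omega⟩
  obtain ⟨m, rfl⟩ : ∃ m : ℕ, n' = n + i + m := ⟨n' - (n + i), by omega⟩
  apply descM hL x z i
  · rw [add_sub_cancel_right]
    apply descP hL x z k' (n + i) m hv
    intro j a b
    exact h2 j (by push_cast at *; omega) (by push_cast at *; omega)
  · intro j a b
    exact h1 j (by omega) (by omega)

theorem em_eq {L : LambdaGraphBisystem A} (hL : IsLGBS L) (x z : Config L) (k : ℤ) (n : ℕ)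
    (hv : x.v (k - 1) (n + 1) = z.v (k - 1) (n + 1)) (h : configSeq x k = configSeq z k) :
    x.em k n = z.em k n :=
  hL.rightResolving n _ _ (by rw [x.em_s, z.em_s, hv]) (by rw [lm_lab, lm_lab, h])

theorem ep_eq {L : LambdaGraphBisystem A} (hL : IsLGBS L) (x z : Config L) (k : ℤ) (n : ℕ)
    (hv : x.v k (n + 1) = z.v k (n + 1))
    (h : configSeq x (k + n + 1) = configSeq z (k + n + 1)) :
    x.ep k n = z.ep k n :=
  hL.leftResolving n _ _ (by rw [x.ep_t, z.ep_t, hv]) (by rw [lp_lab, lp_lab, h])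

theorem rectEq_lab {L : LambdaGraphBisystem A} {x z : Config L} {p q : ℤ}
    (h : RectEq x z p q) : ∀ j, (j ≤ p ∨ q ≤ j) → configSeq x j = configSeq z j := by
  rintro j (hj | hj)
  · have := (h j (q - j).toNat hj (by omega)).2.1
    rw [← lm_lab x j (q - j).toNat, ← lm_lab z j (q - j).toNat, this]
  · have hm : min p (j - 1) + ((j - min p (j - 1) - 1).toNat : ℤ) + 1 = j := by omega
    have := (h (min p (j - 1)) (j - min p (j - 1) - 1).toNat (by omega) (by omega)).2.2
    have e1 := lp_lab x (min p (j - 1)) (j - min p (j - 1) - 1).toNat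
    have e2 := lp_lab z (min p (j - 1)) (j - min p (j - 1) - 1).toNat
    rw [hm] at e1 e2
    rw [← e1, ← e2, this]

theorem rectEq_of {L : LambdaGraphBisystem A} (hL : IsLGBS L) {x z : Config L} {p q : ℤ}
    (hv : ∀ (k : ℤ) (n : ℕ), k ≤ p → q ≤ k + n + 1 → x.v k n = z.v k n)
    (hl : ∀ j, (j ≤ p ∨ q ≤ j) → configSeq x j = configSeq z j) : RectEq x z p q := by
  intro k n h1 h2
  exact ⟨hv k n h1 h2, em_eq hL x z k n (hv _ _ (by omega) (by push_cast; omega)) (hl _ (by omega)),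
    ep_eq hL x z k n (hv _ _ (by omega) (by push_cast; omega)) (hl _ (by omega))⟩

/-- Enlarging a rectangle. -/
theorem rectEq_enlarge {L : LambdaGraphBisystem A} (hL : IsLGBS L) {x z : Config L} {P Q p q : ℤ}
    (h : RectEq x z P Q)
    (hl : ∀ j, (j ≤ p ∨ q ≤ j) → configSeq x j = configSeq z j) : RectEq x z p q := by
  refine rectEq_of hL ?_ hl
  intro k n hk hq
  have hlow : min k P + ((max (k + n + 1) Q - min k P - 1).toNat : ℤ) + 1
      = max (k + n + 1) Q := by omega
  refine desc hL x z (min k P) (max (k + n + 1) Q - min k P - 1).toNat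
    (h _ _ (by omega) (by omega)).1 k n (by omega) (by omega) ?_ ?_
  · intro j h1 h2; exact hl j (by omega)
  · intro j h1 h2; exact hl j (by omega)

theorem config_ext {L : LambdaGraphBisystem A} (hL : IsLGBS L) {x z : Config L} {p q : ℤ}
    (h : RectEq x z p q) (hl : ∀ j, p < j → j < q → configSeq x j = configSeq z j) : x = z := by
  have hl' : ∀ j, configSeq x j = configSeq z j := by
    intro j
    by_cases hj : j ≤ p ∨ q ≤ j
    · exact rectEq_lab h j hj
    · push Not at hj; exact hl j hj.1 hj.2
  have key : ∀ k n, x.v k n = z.v k n ∧ x.em k n = z.em k n ∧ x.ep k n = z.ep k n := by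
    intro k n
    exact rectEq_enlarge hL (p := k) (q := k + n + 1) h (fun j _ => hl' j) k n le_rfl le_rfl
  have h1 : x.v = z.v := by funext k n; exact (key k n).1
  have h2 : x.em = z.em := by funext k n; exact (key k n).2.1
  have h3 : x.ep = z.ep := by funext k n; exact (key k n).2.2
  cases x; cases z
  simp only at h1 h2 h3
  subst h1 h2 h3
  rfl

/-! construction of configurations -/

noncomputable def dm (L : LambdaGraphBisystem A) (n : ℕ) (v : L.V (n + 1)) (a : A) : L.V n :=
  @Classical.epsilon _ (L.nonemptyV n) (fun u => RM L n v a u)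

noncomputable def dp (L : LambdaGraphBisystem A) (n : ℕ) (v : L.V (n + 1)) (a : A) : L.V n :=
  @Classical.epsilon _ (L.nonemptyV n) (fun u => RP L n v a u)

theorem dm_spec {L : LambdaGraphBisystem A} (hL : IsLGBS L) {xs : ℤ → A} {k : ℤ} {n : ℕ}
    {v : L.V (n + 1)} (h : Good L xs k (n + 1) v) :
    RM L n v (xs (k + 1)) (dm L n v (xs (k + 1))) ∧ Good L xs (k + 1) n (dm L n v (xs (k + 1))) := by
  obtain ⟨u, hu, hg⟩ := good_M hL h
  have h1 : RM L n v (xs (k + 1)) (dm L n v (xs (k + 1))) := Classical.epsilon_spec ⟨u, hu⟩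
  exact ⟨h1, by rw [RM_unique hL h1 hu]; exact hg⟩

theorem dp_spec {L : LambdaGraphBisystem A} (hL : IsLGBS L) {xs : ℤ → A} {k : ℤ} {n : ℕ}
    {v : L.V (n + 1)} (h : Good L xs k (n + 1) v) :
    RP L n v (xs (k + n + 1)) (dp L n v (xs (k + n + 1))) ∧
      Good L xs k n (dp L n v (xs (k + n + 1))) := by
  obtain ⟨u, hu, hg⟩ := good_P h
  have h1 : RP L n v (xs (k + n + 1)) (dp L n v (xs (k + n + 1))) := Classical.epsilon_spec ⟨u, hu⟩
  exact ⟨h1, by rw [RP_unique hL h1 hu]; exact hg⟩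

noncomputable def newV (L : LambdaGraphBisystem A) (z : Config L) (xs : ℤ → A) (p q : ℤ)
    (k : ℤ) (n : ℕ) : L.V n :=
  if p < k then dm L n (newV L z xs p q (k - 1) (n + 1)) (xs k)
  else if k + n + 1 < q then dp L n (newV L z xs p q k (n + 1)) (xs (k + n + 1))
  else z.v k n
termination_by (k - p).toNat + (q - k - n - 1).toNat
decreasing_by
  all_goals push_cast
  all_goals omega

theorem newV_gt {L : LambdaGraphBisystem A} (z : Config L) (xs : ℤ → A) (p q : ℤ)
    (k : ℤ) (n : ℕ) (h : p < k) :
    newV L z xs p q k n = dm L n (newV L z xs p q (k - 1) (n + 1)) (xs k) := by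
  rw [newV, if_pos h]

theorem newV_lt {L : LambdaGraphBisystem A} (z : Config L) (xs : ℤ → A) (p q : ℤ)
    (k : ℤ) (n : ℕ) (h : k ≤ p) (h' : k + n + 1 < q) :
    newV L z xs p q k n = dp L n (newV L z xs p q k (n + 1)) (xs (k + n + 1)) := by
  rw [newV, if_neg (by omega), if_pos h']

theorem newV_rect {L : LambdaGraphBisystem A} (z : Config L) (xs : ℤ → A) (p q : ℤ)
    (k : ℤ) (n : ℕ) (h : k ≤ p) (h' : q ≤ k + n + 1) :
    newV L z xs p q k n = z.v k n := by
  rw [newV, if_neg (by omega), if_neg (by omega)]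

theorem good_rect {L : LambdaGraphBisystem A} (hL : IsLGBS L) (z : Config L) (xs : ℤ → A) (p : ℤ)
    (n₀ : ℕ) (hxs : ∀ j, (j ≤ p ∨ p + n₀ + 1 ≤ j) → xs j = configSeq z j)
    (hg : Good L xs p n₀ (z.v p n₀)) (k : ℤ) (n : ℕ) (h : k ≤ p) (h' : p + n₀ + 1 ≤ k + n + 1) :
    Good L xs k n (z.v k n) := by
  have row : ∀ m : ℕ, Good L xs p (n₀ + m) (z.v p (n₀ + m)) := by
    intro m
    induction m with
    | zero => exact hg
    | succ m ih =>
      refine good_of_P (n := n₀ + m) ?_ ih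
      rw [hxs _ (by push_cast; omega)]
      exact rP z p (n₀ + m)
  have col : ∀ i m : ℕ, Good L xs (p - i) (n₀ + m + i) (z.v (p - i) (n₀ + m + i)) := by
    intro i m
    induction i with
    | zero => simpa using row m
    | succ i ih =>
      have e : (p - ((i + 1 : ℕ) : ℤ)) = p - i - 1 := by push_cast; ring
      rw [e]
      refine good_of_M hL (n := n₀ + m + i) (u := z.v (p - i) (n₀ + m + i)) ?_ ?_
      · rw [sub_add_cancel, hxs _ (by omega)]
        exact rM z (p - i) (n₀ + m + i)
      · rw [sub_add_cancel]; exact ih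
  obtain ⟨i, rfl⟩ : ∃ i : ℕ, k = p - i := ⟨(p - k).toNat, by omega⟩
  obtain ⟨m, rfl⟩ : ∃ m : ℕ, n = n₀ + m + i := ⟨n - (n₀ + i), by omega⟩
  exact col i m

theorem exists_config {L : LambdaGraphBisystem A} (hL : IsLGBS L) (x z : Config L) (p : ℤ)
    (n₀ : ℕ) (hv : x.v p n₀ = z.v p n₀) :
    ∃ w : Config L, RectEq w z p (p + n₀ + 1) ∧
      ∀ j, p < j → j ≤ p + n₀ → configSeq w j = configSeq x j := by
  classical
  set xs : ℤ → A := fun j => if p < j ∧ j ≤ p + n₀ then configSeq x j else configSeq z j with hxsdef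
  have hxs : ∀ j, (j ≤ p ∨ p + n₀ + 1 ≤ j) → xs j = configSeq z j := by
    intro j hj
    exact if_neg (by omega)
  have hxs' : ∀ j, p < j → j ≤ p + n₀ → xs j = configSeq x j := by
    intro j h1 h2
    exact if_pos ⟨h1, h2⟩
  have hg : Good L xs p n₀ (z.v p n₀) := by
    rw [Good, (word_eq_iff xs (configSeq x) p n₀).2 hxs', ← hv]
    exact good_config x p n₀
  set q := p + n₀ + 1 with hq
  let V := newV L z xs p q
  have V1 : ∀ k n, p < k → V k n = dm L n (V (k - 1) (n + 1)) (xs k) := newV_gt z xs p q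
  have V2 : ∀ (k : ℤ) (n : ℕ), k ≤ p → k + n + 1 < q → V k n = dp L n (V k (n + 1)) (xs (k + n + 1)) :=
    newV_lt z xs p q
  have V3 : ∀ (k : ℤ) (n : ℕ), k ≤ p → q ≤ k + n + 1 → V k n = z.v k n := newV_rect z xs p q
  clear_value V
  have goodL : ∀ (N : ℕ) (k : ℤ) (n : ℕ), k ≤ p → q ≤ k + n + 1 + N → Good L xs k n (V k n) := by
    intro N
    induction N with
    | zero =>
      intro k n h1 h2
      rw [V3 k n h1 (by simpa using h2)]
      exact good_rect hL z xs p n₀ hxs hg k n h1 (by push_cast at h2; omega)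
    | succ N ih =>
      intro k n h1 h2
      by_cases h3 : k + n + 1 < q
      · rw [V2 k n h1 h3]
        exact (dp_spec hL (ih k (n + 1) h1 (by push_cast at *; omega))).2
      · rw [V3 k n h1 (by omega)]
        exact good_rect hL z xs p n₀ hxs hg k n h1 (by omega)
  have good0 : ∀ (k : ℤ) (n : ℕ), k ≤ p → Good L xs k n (V k n) := fun k n h =>
    goodL (q - (k + n + 1)).toNat k n h (by omega)
  have goodR : ∀ (N : ℕ) (k : ℤ) (n : ℕ), k ≤ p + N → Good L xs k n (V k n) := by
    intro N
    induction N with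
    | zero => intro k n h; exact good0 k n (by simpa using h)
    | succ N ih =>
      intro k n h
      by_cases h1 : p < k
      · rw [V1 k n h1]
        have := (dm_spec hL (ih (k - 1) (n + 1) (by push_cast at *; omega))).2
        rw [sub_add_cancel] at this
        exact this
      · exact good0 k n (by omega)
  have good : ∀ (k : ℤ) (n : ℕ), Good L xs k n (V k n) := fun k n =>
    goodR (k - p).toNat k n (by omega)
  -- the two families of relations
  have M1 : ∀ (k : ℤ) (n : ℕ), p < k → RM L n (V (k - 1) (n + 1)) (xs k) (V k n) := by
    intro k n h
    rw [V1 k n h]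
    have := (dm_spec hL (good (k - 1) (n + 1))).1
    rw [sub_add_cancel] at this
    exact this
  have P1 : ∀ (k : ℤ) (n : ℕ), k ≤ p → RP L n (V k (n + 1)) (xs (k + n + 1)) (V k n) := by
    intro k n h
    by_cases h1 : k + n + 1 < q
    · rw [V2 k n h h1]
      exact (dp_spec hL (good k (n + 1))).1
    · rw [V3 k n h (by omega), V3 k (n + 1) h (by push_cast; omega), hxs _ (by omega)]
      exact rP z k n
  have M2 : ∀ (N : ℕ) (k : ℤ) (n : ℕ), k ≤ p → q ≤ k + n + 1 + N →
      RM L n (V (k - 1) (n + 1)) (xs k) (V k n) := by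
    intro N
    induction N with
    | zero =>
      intro k n h1 h2
      rw [V3 k n h1 (by simpa using h2), V3 (k - 1) (n + 1) (by omega) (by push_cast at *; omega),
        hxs _ (by omega)]
      exact rM z k n
    | succ N ih =>
      intro k n h1 h2
      have a1 := ih k (n + 1) h1 (by push_cast at *; omega)
      have a2 := P1 k n h1
      have a3 := P1 (k - 1) (n + 1) (by omega)
      have e : k - 1 + ((n + 1 : ℕ) : ℤ) + 1 = k + n + 1 := by push_cast; ring
      rw [e] at a3
      exact square_M hL a1 a2 a3
  have M : ∀ (k : ℤ) (n : ℕ), RM L n (V (k - 1) (n + 1)) (xs k) (V k n) := by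
    intro k n
    by_cases h : p < k
    · exact M1 k n h
    · exact M2 (q - (k + n + 1)).toNat k n (by omega) (by omega)
  have P2 : ∀ (N : ℕ) (k : ℤ) (n : ℕ), k ≤ p + N →
      RP L n (V k (n + 1)) (xs (k + n + 1)) (V k n) := by
    intro N
    induction N with
    | zero => intro k n h; exact P1 k n (by simpa using h)
    | succ N ih =>
      intro k n h
      have a1 := ih (k - 1) (n + 1) (by push_cast at *; omega)
      have e : k - 1 + ((n + 1 : ℕ) : ℤ) + 1 = k + n + 1 := by push_cast; ring
      rw [e] at a1
      exact square_P hL a1 (M k n) (M k (n + 1))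
  have P : ∀ (k : ℤ) (n : ℕ), RP L n (V k (n + 1)) (xs (k + n + 1)) (V k n) := fun k n =>
    P2 (k - p).toNat k n (by omega)
  choose em em1 em2 em3 using M
  choose ep ep1 ep2 ep3 using P
  let w : Config L :=
    { v := V, em := em, ep := ep, em_s := em1, em_t := em3, ep_s := ep3, ep_t := ep1
      label := ⟨xs, em2, ep2⟩ }
  have hw : ∀ j, configSeq w j = xs j := fun j => em2 j 0
  refine ⟨w, rectEq_of hL V3 ?_, ?_⟩
  · intro j hj; rw [hw, hxs j hj]
  · intro j h1 h2; rw [hw, hxs' j h1 h2]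

/-! topology -/

def Box {L : LambdaGraphBisystem A} (x : Config L) (p : ℤ) (n : ℕ) : Set (Config L) :=
  {y | y.v p n = x.v p n ∧ ∀ j, p < j → j ≤ p + n → configSeq y j = configSeq x j}

theorem box_eq {L : LambdaGraphBisystem A} (x : Config L) (p : ℤ) (n : ℕ) :
    Box x p n = Cyl p n (x.v p n) (Pword x p n) := by
  ext y
  simp only [Box, Cyl, Set.mem_setOf_eq, Pword_eq, word_eq_iff]

theorem mem_box {L : LambdaGraphBisystem A} (x : Config L) (p : ℤ) (n : ℕ) : x ∈ Box x p n :=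
  ⟨rfl, fun _ _ _ => rfl⟩

theorem isOpen_box {L : LambdaGraphBisystem A} (x : Config L) (p : ℤ) (n : ℕ) :
    IsOpen (Box x p n) := by
  apply TopologicalSpace.isOpen_generateFrom_of_mem
  refine ⟨p, n, x.v p n, Pword x p n, ?_, box_eq x p n⟩
  rw [Pword_eq]; exact good_config x p n

theorem box_mono {L : LambdaGraphBisystem A} (hL : IsLGBS L) (x : Config L) {p P : ℤ} {n N : ℕ}
    (h1 : P ≤ p) (h2 : p + n ≤ P + N) : Box x P N ⊆ Box x p n := by
  rintro y ⟨hy1, hy2⟩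
  refine ⟨desc hL y x P N hy1 p n h1 h2 ?_ ?_, ?_⟩
  all_goals intro j a b; exact hy2 j (by omega) (by omega)

theorem exists_box {L : LambdaGraphBisystem A} (hL : IsLGBS L) {W : Set (Config L)}
    (hW : IsOpen W) : ∀ x ∈ W, ∃ (p : ℤ) (n : ℕ), Box x p n ⊆ W := by
  have hW' : TopologicalSpace.GenerateOpen (cylinderSets L) W := hW
  induction hW' with
  | basic s hs =>
    obtain ⟨p, n, v, μ, hμ, rfl⟩ := hs
    rintro x ⟨rfl, rfl⟩
    exact ⟨p, n, (box_eq x p n).le⟩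
  | univ => intro x _; exact ⟨0, 0, Set.subset_univ _⟩
  | inter s t hs ht ihs iht =>
    rintro x ⟨hx1, hx2⟩
    obtain ⟨p, n, h⟩ := ihs hs x hx1
    obtain ⟨p', n', h'⟩ := iht ht x hx2
    refine ⟨min p p', (max (p + n) (p' + n') - min p p').toNat, fun y hy => ⟨h ?_, h' ?_⟩⟩
    · exact box_mono hL x (by omega) (by omega) hy
    · exact box_mono hL x (by omega) (by omega) hy
  | sUnion S hS ih =>
    rintro x ⟨s, hs, hx⟩
    obtain ⟨p, n, h⟩ := ih s hs (hS s hs) x hx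
    exact ⟨p, n, h.trans (Set.subset_sUnion_of_mem hs)⟩

theorem isOpen_ind {L : LambdaGraphBisystem A} (W : Set ↥(Rset L)) :
    @IsOpen _ (indTop L) W ↔ ∀ (p q : ℤ) (h : p < q), IsOpen (inclPQ L p q h ⁻¹' W) := by
  unfold indTop
  rw [isOpen_iSup_iff]
  refine forall_congr' fun p => ?_
  rw [isOpen_iSup_iff]
  refine forall_congr' fun q => ?_
  rw [isOpen_iSup_iff]
  exact forall_congr' fun h => isOpen_coinduced

theorem continuous_snd' (L : LambdaGraphBisystem A) :
    @Continuous _ _ (indTop L) _ (fun y : ↥(Rset L) => y.val.2) := by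
  letI := indTop L
  refine ⟨fun U hU => (isOpen_ind _).2 fun p q h => ?_⟩
  exact hU.preimage (continuous_snd.comp continuous_subtype_val)

theorem isOpenMap_snd {L : LambdaGraphBisystem A} (hL : IsLGBS L) :
    @IsOpenMap _ _ (indTop L) _ (fun y : ↥(Rset L) => y.val.2) := by
  letI := indTop L
  intro W hW
  rw [isOpen_iff_forall_mem_open]
  rintro _ ⟨⟨⟨x, z⟩, p, q, hpq, hR⟩, hy, rfl⟩
  have hW' := (isOpen_ind W).1 hW p q hpq
  obtain ⟨T, hT, hTW⟩ := isOpen_induced_iff.1 hW'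
  have hmem : (x, z) ∈ T := by
    have : (⟨(x, z), hR⟩ : ↥(RpqSet L p q)) ∈ Subtype.val ⁻¹' T := by rw [hTW]; exact hy
    exact this
  obtain ⟨T1, T2, o1, o2, m1, m2, hsub⟩ := isOpen_prod_iff.1 hT x z hmem
  obtain ⟨p1, n1, b1⟩ := exists_box hL o1 x m1
  obtain ⟨p2, n2, b2⟩ := exists_box hL o2 z m2
  simp only at hR
  obtain ⟨P, hP⟩ : ∃ P, P = min p (min p1 p2) := ⟨_, rfl⟩
  obtain ⟨N, hN⟩ : ∃ N : ℕ, N = (max q (max (p1 + n1) (p2 + n2)) - P).toNat := ⟨_, rfl⟩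
  refine ⟨Box z P N, ?_, isOpen_box z P N, mem_box z P N⟩
  intro z' hz'
  have hxz : x.v P N = z'.v P N := by
    rw [hz'.1]; exact (hR P N (by omega) (by omega)).1
  obtain ⟨x', hx1, hx2⟩ := exists_config hL x z' P N hxz
  have hlabR := rectEq_lab hR
  have hlab' := rectEq_lab hx1
  have hR' : RectEq x' z' p q := by
    refine rectEq_enlarge hL hx1 fun j hj => ?_
    by_cases hc : P < j ∧ j ≤ P + N
    · rw [hx2 j hc.1 hc.2, hz'.2 j hc.1 hc.2, hlabR j hj]
    · exact hlab' j (by omega)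
  have hx'box : x' ∈ Box x P N :=
    ⟨by rw [hxz]; exact (hx1 P N le_rfl le_rfl).1, hx2⟩
  have hT' : (⟨(x', z'), hR'⟩ : ↥(RpqSet L p q)) ∈ Subtype.val ⁻¹' T :=
    hsub ⟨b1 (box_mono hL x (by omega) (by omega) hx'box),
      b2 (box_mono hL z (by omega) (by omega) hz')⟩
  rw [hTW] at hT'
  exact ⟨_, hT', rfl⟩

def Nb {L : LambdaGraphBisystem A} (x : Config L) (p q : ℤ) : Set ↥(Rset L) :=
  {y | RectEq y.val.1 y.val.2 p q ∧ ∀ j, p < j → j < q → configSeq y.val.1 j = configSeq x j}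

theorem isOpen_Nb {L : LambdaGraphBisystem A} (hL : IsLGBS L) (x : Config L) (p q : ℤ) :
    @IsOpen _ (indTop L) (Nb x p q) := by
  rw [isOpen_ind]
  intro p' q' h
  rw [isOpen_iff_forall_mem_open]
  rintro ⟨⟨x1, z1⟩, h1⟩ ⟨h2, h3⟩
  change RectEq x1 z1 p' q' at h1
  change RectEq x1 z1 p q at h2
  change ∀ j, p < j → j < q → configSeq x1 j = configSeq x j at h3
  obtain ⟨P, hP⟩ : ∃ P, P = min p p' := ⟨_, rfl⟩
  obtain ⟨N, hN⟩ : ∃ N : ℕ, N = (max q q' - P).toNat := ⟨_, rfl⟩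
  refine ⟨Subtype.val ⁻¹' (Box x1 P N ×ˢ Box z1 P N), ?_,
    ((isOpen_box x1 P N).prod (isOpen_box z1 P N)).preimage continuous_subtype_val,
    ⟨mem_box x1 P N, mem_box z1 P N⟩⟩
  rintro ⟨⟨x2, z2⟩, g1⟩ ⟨g2, g3⟩
  change RectEq x2 z2 p' q' at g1
  change x2 ∈ Box x1 P N at g2
  change z2 ∈ Box z1 P N at g3
  have l1 := rectEq_lab h2
  have l2 := rectEq_lab g1
  refine ⟨rectEq_enlarge hL g1 fun j hj => ?_, fun j a b => ?_⟩
  · change configSeq x2 j = configSeq z2 j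
    by_cases hc : P < j ∧ j ≤ P + N
    · rw [g2.2 j hc.1 hc.2, g3.2 j hc.1 hc.2, l1 j hj]
    · exact l2 j (by omega)
  · change configSeq x2 j = configSeq x j
    rw [g2.2 j (by omega) (by omega), h3 j a b]

theorem injOn_Nb {L : LambdaGraphBisystem A} (hL : IsLGBS L) (x : Config L) (p q : ℤ) :
    Set.InjOn (fun y : ↥(Rset L) => y.val.2) (Nb x p q) := by
  rintro ⟨⟨x1, z1⟩, h1⟩ ⟨a1, a2⟩ ⟨⟨x2, z2⟩, h2⟩ ⟨b1, b2⟩ heq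
  simp only at heq a1 a2 b1 b2
  subst heq
  have : x1 = x2 := by
    refine config_ext hL (p := p) (q := q) ?_ ?_
    · intro k n h h'
      obtain ⟨c1, c2, c3⟩ := a1 k n h h'
      obtain ⟨d1, d2, d3⟩ := b1 k n h h'
      exact ⟨c1.trans d1.symm, c2.trans d2.symm, c3.trans d3.symm⟩
    · intro j a b; rw [a2 j a b, b2 j a b]
  subst this
  rfl

theorem isLocalHomeomorph_snd {L : LambdaGraphBisystem A} (hL : IsLGBS L) :
    @IsLocalHomeomorph _ _ (indTop L) _ (fun y : ↥(Rset L) => y.val.2) := by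
  letI := indTop L
  rw [isLocalHomeomorph_iff_isOpenEmbedding_restrict]
  rintro ⟨⟨x, z⟩, p, q, hpq, hR⟩
  have ho : IsOpen (Nb x p q) := isOpen_Nb hL x p q
  refine ⟨Nb x p q, ho.mem_nhds ⟨hR, fun _ _ _ => rfl⟩, ?_⟩
  refine Topology.IsOpenEmbedding.of_continuous_injective_isOpenMap ?_ ?_ ?_
  · exact (continuous_snd' L).comp continuous_subtype_val
  · exact (injOn_Nb hL x p q).injective
  · exact (isOpenMap_snd hL).restrict ho

theorem rectEq_symm {L : LambdaGraphBisystem A} {x z : Config L} {p q : ℤ}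
    (h : RectEq x z p q) : RectEq z x p q := fun k n a b =>
  ⟨(h k n a b).1.symm, (h k n a b).2.1.symm, (h k n a b).2.2.symm⟩

def swp (L : LambdaGraphBisystem A) (y : ↥(Rset L)) : ↥(Rset L) :=
  ⟨(y.val.2, y.val.1), by
    obtain ⟨p, q, h, hR⟩ := y.prop
    exact ⟨p, q, h, rectEq_symm hR⟩⟩

theorem continuous_swp (L : LambdaGraphBisystem A) :
    @Continuous _ _ (indTop L) (indTop L) (swp L) := by
  letI := indTop L
  refine ⟨fun U hU => (isOpen_ind _).2 fun p q h => ?_⟩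
  have h1 := (isOpen_ind U).1 hU p q h
  have hc : Continuous (fun y : ↥(RpqSet L p q) =>
      (⟨(y.val.2, y.val.1), rectEq_symm y.prop⟩ : ↥(RpqSet L p q))) := by
    fun_prop
  exact h1.preimage hc

theorem isLocalHomeomorph_fst {L : LambdaGraphBisystem A} (hL : IsLGBS L) :
    @IsLocalHomeomorph _ _ (indTop L) _ (fun y : ↥(Rset L) => y.val.1) := by
  letI := indTop L
  let e : ↥(Rset L) ≃ₜ ↥(Rset L) :=
    { toFun := swp L, invFun := swp L, left_inv := fun _ => rfl, right_inv := fun _ => rfl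
      continuous_toFun := continuous_swp L, continuous_invFun := continuous_swp L }
  exact (isLocalHomeomorph_snd hL).comp e.isLocalHomeomorph

end LHaux

/-- The source and range maps `s(x,z) = z`, `r(x,z) = x` are local
homeomorphisms from `R_L` (with the inductive limit topology) to `X_L`; hence the
equivalence relation `R_L` is étale. -/
theorem source_range_localHomeomorph {A : Type} [Fintype A]
    (L : LambdaGraphBisystem A) (hL : IsLGBS L) :
    @IsLocalHomeomorph _ _ (indTop L) _ (fun y : ↥(Rset L) => y.val.2) ∧
    @IsLocalHomeomorph _ _ (indTop L) _ (fun y : ↥(Rset L) => y.val.1) := by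
  exact ⟨LHaux.isLocalHomeomorph_snd hL, LHaux.isLocalHomeomorph_fst hL⟩
end

section
/- Let L be a λ-graph bisystem over a finite alphabet Σ satisfying FPCC. For each (p,q) ∈ ℤ² with p < q, the subequivalence relation R_{L,(p,q)} is a compact open subset of R_L; moreover R_{L,(p,q)} ⊆ R_{L,(p',q')} whenever p' ≤ p and q ≤ q', and R_L = ⋃_{p<q} R_{L,(p,q)}. Hence R_L is an étale AF equivalence relation. -/
variable {A : Type}

/-! ## Helper material -/

namespace LGB

open Topology

/-- There is a labeled edge of `L⁺`. -/
def EP (L : LambdaGraphBisystem A) (n : ℕ) (a : A) (u : L.V n) (w : L.V (n + 1)) : Prop :=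
  ∃ e : L.Ep n, L.sp n e = u ∧ L.tp n e = w ∧ L.lp n e = a

/-- There is a labeled edge of `L⁻`. -/
def EM (L : LambdaGraphBisystem A) (n : ℕ) (a : A) (w : L.V (n + 1)) (u : L.V n) : Prop :=
  ∃ e : L.Em n, L.sm n e = w ∧ L.tm n e = u ∧ L.lm n e = a

variable {L : LambdaGraphBisystem A}

theorem EP.uniq (hL : IsLGBS L) {n : ℕ} {a : A} {u u' : L.V n} {w : L.V (n + 1)}
    (h : EP L n a u w) (h' : EP L n a u' w) : u = u' := by
  obtain ⟨e, h1, h2, h3⟩ := h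
  obtain ⟨e', h1', h2', h3'⟩ := h'
  have := hL.leftResolving n e e' (h2.trans h2'.symm) (h3.trans h3'.symm)
  subst this
  exact h1.symm.trans h1'

theorem EM.uniq (hL : IsLGBS L) {n : ℕ} {a : A} {u u' : L.V n} {w : L.V (n + 1)}
    (h : EM L n a w u) (h' : EM L n a w u') : u = u' := by
  obtain ⟨e, h1, h2, h3⟩ := h
  obtain ⟨e', h1', h2', h3'⟩ := h'
  have := hL.rightResolving n e e' (h1.trans h1'.symm) (h3.trans h3'.symm)
  subst this
  exact h2.symm.trans h2'

theorem local1 (hL : IsLGBS L) {n : ℕ} {a b : A} {u : L.V n} {w : L.V (n + 1)} {t : L.V (n + 2)}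
    (h1 : EP L n a u w) (h2 : EM L (n + 1) b t w) :
    ∃ s : L.V (n + 1), EM L n b s u ∧ EP L (n + 1) a s t := by
  obtain ⟨e, e1, e2, e3⟩ := h1
  obtain ⟨f, f1, f2, f3⟩ := h2
  obtain ⟨φ, hφ⟩ := hL.localProperty n u t
  let X : {fp : L.Ep n × L.Em (n + 1) //
            L.sp n fp.1 = u ∧ L.tp n fp.1 = L.tm (n + 1) fp.2 ∧ L.sm (n + 1) fp.2 = t} :=
    ⟨(e, f), e1, e2.trans f2.symm, f1⟩
  have h := hφ X
  have hp := (φ X).2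
  refine ⟨L.sm n (φ X).1.1, ⟨(φ X).1.1, rfl, hp.1, ?_⟩, ⟨(φ X).1.2, hp.2.1.symm, hp.2.2, ?_⟩⟩
  · exact h.2.symm.trans f3
  · exact h.1.symm.trans e3

theorem local2 (hL : IsLGBS L) {n : ℕ} {a b : A} {u : L.V n} {s : L.V (n + 1)} {t : L.V (n + 2)}
    (h1 : EM L n b s u) (h2 : EP L (n + 1) a s t) :
    ∃ w : L.V (n + 1), EP L n a u w ∧ EM L (n + 1) b t w := by
  obtain ⟨e, e1, e2, e3⟩ := h1
  obtain ⟨f, f1, f2, f3⟩ := h2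
  obtain ⟨φ, hφ⟩ := hL.localProperty n u t
  let Y : {ee : L.Em n × L.Ep (n + 1) //
            L.tm n ee.1 = u ∧ L.sm n ee.1 = L.sp (n + 1) ee.2 ∧ L.tp (n + 1) ee.2 = t} :=
    ⟨(e, f), e2, e1.trans f1.symm, f2⟩
  have h := hφ (φ.symm Y)
  rw [Equiv.apply_symm_apply] at h
  have hp := (φ.symm Y).2
  refine ⟨L.tp n (φ.symm Y).1.1, ⟨(φ.symm Y).1.1, hp.1, rfl, ?_⟩,
    ⟨(φ.symm Y).1.2, hp.2.2, hp.2.1.symm, ?_⟩⟩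
  · exact h.1.trans f3
  · exact h.2.trans e3

theorem fpcc1 (hL : IsLGBS L) {a : A} {u : L.V 0} {w : L.V 1} :
    EP L 0 a u w ↔ EM L 0 a w u := by
  have := hL.subsingletonV0
  have h := congrArg (fun S => [a] ∈ S) (hL.fpcc 1 w)
  simp only [LambdaGraphBisystem.Fset, LambdaGraphBisystem.Pset, Set.mem_ofPred_eq,
    Set.mem_singleton_iff, eq_iff_iff] at h
  constructor
  · rintro ⟨e, h1, h2, h3⟩
    obtain ⟨f, f1, w', rfl, f2⟩ := h.2 ⟨e, h2, [], rfl, by simp [h3]⟩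
    exact ⟨f, f1, Subsingleton.elim _ _, by simpa using f2.symm⟩
  · rintro ⟨e, h1, h2, h3⟩
    obtain ⟨f, f1, w', rfl, f2⟩ := h.1 ⟨e, h1, [], rfl, by simp [h3]⟩
    exact ⟨f, Subsingleton.elim _ _, f1, by simpa using f2.symm⟩

/-- A row at height `k` with labels `y`. -/
def Row (L : LambdaGraphBisystem A) (y : ℤ → A) (k : ℤ) (v : ∀ n, L.V n) : Prop :=
  ∀ n : ℕ, EP L n (y (k + n + 1)) (v n) (v (n + 1))

/-- Two consecutive rows at heights `k-1` and `k`. -/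
def Link (L : LambdaGraphBisystem A) (y : ℤ → A) (k : ℤ) (v' v : ∀ n, L.V n) : Prop :=
  ∀ n : ℕ, EM L n (y k) (v' (n + 1)) (v n)

theorem row_up (hL : IsLGBS L) {y : ℤ → A} {k : ℤ} {v : ∀ n, L.V n} (h : Row L y k v) :
    ∃ v', Row L y (k + 1) v' ∧ Link L y (k + 1) v v' := by
  classical
  have h0 : EM L 0 (y (k + 1)) (v 1) (v 0) := by
    have := (fpcc1 hL).1 (h 0)
    simpa using this
  have hs : ∀ n (u : {u : L.V n // EM L n (y (k + 1)) (v (n + 1)) u}),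
      ∃ w : {u : L.V (n + 1) // EM L (n + 1) (y (k + 1)) (v (n + 1 + 1)) u},
        EP L n (y (k + 1 + n + 1)) u.1 w.1 := by
    rintro n ⟨u, hu⟩
    obtain ⟨w, w1, w2⟩ := local2 hL hu (h (n + 1))
    refine ⟨⟨w, w2⟩, ?_⟩
    have e : k + ((n + 1 : ℕ) : ℤ) + 1 = k + 1 + n + 1 := by push_cast; ring
    rwa [e] at w1
  choose g hg using hs
  let r : ∀ n, {u : L.V n // EM L n (y (k + 1)) (v (n + 1)) u} :=
    fun n => Nat.rec ⟨v 0, h0⟩ (fun n u => g n u) n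
  exact ⟨fun n => (r n).1, fun n => hg n (r n), fun n => (r n).2⟩

theorem row_down (hL : IsLGBS L) {y : ℤ → A} {k : ℤ} {v : ∀ n, L.V n} (h : Row L y k v)
    (N : ℕ) : ∀ (t : ∀ n, L.V n)
    (_ : ∀ n : ℕ, N ≤ n → EP L n (y (k - 1 + n + 1)) (t n) (t (n + 1)))
    (_ : ∀ n : ℕ, N ≤ n + 1 → EM L n (y k) (t (n + 1)) (v n)),
    ∃ v', Row L y (k - 1) v' ∧ Link L y k v' v ∧ ∀ n, N ≤ n → v' n = t n := by
  classical
  induction N with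
  | zero =>
    intro t h1 h2
    exact ⟨t, fun n => h1 n (Nat.zero_le _), fun n => h2 n (Nat.zero_le _), fun _ _ => rfl⟩
  | succ N ih =>
    intro t h1 h2
    have key : ∃ s : L.V N, EP L N (y (k - 1 + N + 1)) s (t (N + 1)) ∧
        ∀ m, ∀ e : m + 1 = N, EM L m (y k) (e ▸ s) (v m) := by
      cases N with
      | zero =>
        refine ⟨v 0, ?_, fun m e => by omega⟩
        have := (fpcc1 hL).2 (h2 0 le_rfl)
        simpa using this
      | succ m =>
        obtain ⟨s, s1, s2⟩ := local1 hL (h m) (h2 (m + 1) le_rfl)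
        refine ⟨s, ?_, ?_⟩
        · have e : k - 1 + ((m + 1 : ℕ) : ℤ) + 1 = k + m + 1 := by push_cast; ring
          rw [e]; exact s2
        · intro m' e
          have : m' = m := by omega
          subst this
          exact s1
    obtain ⟨s, s1, s2⟩ := key
    obtain ⟨v', a, b, c⟩ := ih (Function.update t N s) (by
        intro n hn
        rcases Nat.eq_or_lt_of_le hn with rfl | hn
        · rw [Function.update_self, Function.update_of_ne (by omega)]
          exact s1
        · rw [Function.update_of_ne (by omega), Function.update_of_ne (by omega)]
          exact h1 n hn) (by
        intro n hn
        rcases Nat.eq_or_lt_of_le hn with rfl | hn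
        · rw [Function.update_self]
          exact s2 n rfl
        · rw [Function.update_of_ne (by omega)]
          exact h2 n hn)
    refine ⟨v', a, b, fun n hn => ?_⟩
    rw [c n (by omega), Function.update_of_ne (by omega)]

theorem int_choice {α : Type*} (S : ℤ → α → Prop) (T : ℤ → α → α → Prop) (p : ℤ) (a : α)
    (ha : S p a) (hu : ∀ k, p ≤ k → ∀ v, S k v → ∃ v', S (k + 1) v' ∧ T (k + 1) v v')
    (hd : ∀ k, k ≤ p → ∀ v, S k v → ∃ v', S (k - 1) v' ∧ T k v' v) :
    ∃ f : ℤ → α, f p = a ∧ (∀ k, S k (f k)) ∧ ∀ k, T k (f (k - 1)) (f k) := by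
  classical
  have hu' : ∀ (n : ℕ) (v : {v // S (p + n) v}), ∃ v' : {v // S (p + (n + 1 : ℕ)) v},
      T (p + n + 1) v.1 v'.1 := by
    rintro n ⟨v, hv⟩
    obtain ⟨v', h1, h2⟩ := hu (p + n) (by omega) v hv
    exact ⟨⟨v', by push_cast; rwa [← add_assoc]⟩, h2⟩
  have hd' : ∀ (n : ℕ) (v : {v // S (p - n) v}), ∃ v' : {v // S (p - (n + 1 : ℕ)) v},
      T (p - n) v'.1 v.1 := by
    rintro n ⟨v, hv⟩
    obtain ⟨v', h1, h2⟩ := hd (p - n) (by omega) v hv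
    exact ⟨⟨v', by push_cast; rwa [← sub_sub]⟩, h2⟩
  choose gu hgu using hu'
  choose gd hgd using hd'
  let U : ∀ n : ℕ, {v // S (p + n) v} :=
    fun n => Nat.rec ⟨a, by simpa using ha⟩ (fun n u => gu n u) n
  let D : ∀ n : ℕ, {v // S (p - n) v} :=
    fun n => Nat.rec ⟨a, by simpa using ha⟩ (fun n u => gd n u) n
  have hU : ∀ n : ℕ, T (p + n + 1) (U n).1 (U (n + 1)).1 := fun n => hgu n (U n)
  have hD : ∀ n : ℕ, T (p - n) (D (n + 1)).1 (D n).1 := fun n => hgd n (D n)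
  have hU0 : (U 0).1 = a := rfl
  have hD0 : (D 0).1 = a := rfl
  clear_value U D
  let f : ℤ → α := fun k => if p ≤ k then (U (k - p).toNat).1 else (D (p - k).toNat).1
  have fU : ∀ n : ℕ, f (p + n) = (U n).1 := by
    intro n
    have : (p + n - p).toNat = n := by omega
    simp only [f]
    rw [if_pos (by omega), this]
  have fD : ∀ n : ℕ, f (p - n) = (D n).1 := by
    intro n
    have : (p - (p - n)).toNat = n := by omega
    rcases Nat.eq_zero_or_pos n with rfl | hn
    · have := fU 0
      simp only [Nat.cast_zero, add_zero, sub_zero] at this ⊢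
      rw [this, hU0, hD0]
    · simp only [f]
      rw [if_neg (by omega), this]
  refine ⟨f, ?_, ?_, ?_⟩
  · have := fU 0
    simpa [hU0] using this
  · intro k
    rcases le_total p k with h | h
    · obtain ⟨n, rfl⟩ := Int.le.dest h
      rw [fU]; exact (U n).2
    · obtain ⟨n, hn⟩ := Int.le.dest h
      have : k = p - n := by omega
      subst this
      rw [fD]; exact (D n).2
  · intro k
    rcases lt_or_ge p k with h | h
    · obtain ⟨n, hn⟩ := Int.le.dest (Int.add_one_le_of_lt h)
      have e1 : k - 1 = p + n := by omega
      have e2 : k = p + (n + 1 : ℕ) := by push_cast; omega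
      have e3 : k = p + n + 1 := by omega
      have := hU n
      rw [← fU, ← fU, ← e1, ← e2] at this
      rwa [show k - 1 + 1 = k by ring] at this
    · obtain ⟨n, hn⟩ := Int.le.dest h
      have e1 : k = p - n := by omega
      have e2 : k - 1 = p - (n + 1 : ℕ) := by push_cast; omega
      have := hD n
      rwa [← fD, ← fD, ← e1, ← e2] at this

theorem lm_eq (x : Config L) (k : ℤ) (n : ℕ) : L.lm n (x.em k n) = configSeq x k := by
  obtain ⟨xs, h1, h2⟩ := x.label
  rw [configSeq, h1, h1]

theorem lp_eq (x : Config L) (k : ℤ) (n : ℕ) :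
    L.lp n (x.ep k n) = configSeq x (k + n + 1) := by
  obtain ⟨xs, h1, h2⟩ := x.label
  rw [configSeq, h1, h2]

theorem EP_of (x : Config L) (k : ℤ) (n : ℕ) :
    EP L n (configSeq x (k + n + 1)) (x.v k n) (x.v k (n + 1)) :=
  ⟨x.ep k n, x.ep_s k n, x.ep_t k n, lp_eq x k n⟩

theorem EM_of (x : Config L) (k : ℤ) (n : ℕ) :
    EM L n (configSeq x k) (x.v (k - 1) (n + 1)) (x.v k n) :=
  ⟨x.em k n, x.em_s k n, x.em_t k n, lm_eq x k n⟩

theorem exists_config (y : ℤ → A) (v : ℤ → ∀ n, L.V n)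
    (h1 : ∀ (k : ℤ) (n : ℕ), EP L n (y (k + n + 1)) (v k n) (v k (n + 1)))
    (h2 : ∀ (k : ℤ) (n : ℕ), EM L n (y k) (v (k - 1) (n + 1)) (v k n)) :
    ∃ x : Config L, x.v = v ∧ configSeq x = y := by
  choose ep a1 a2 a3 using h1
  choose em b1 b2 b3 using h2
  exact ⟨⟨v, em, ep, b1, b2, a1, a2, y, b3, a3⟩, rfl, funext fun k => b3 k 0⟩

theorem config_ext (hL : IsLGBS L) {x z : Config L} (h : x.v = z.v)
    (hs : configSeq x = configSeq z) : x = z := by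
  have hm : x.em = z.em := by
    funext k n
    exact hL.rightResolving n _ _ (by rw [x.em_s, z.em_s, h]) (by rw [lm_eq, lm_eq, hs])
  have hp : x.ep = z.ep := by
    funext k n
    exact hL.leftResolving n _ _ (by rw [x.ep_t, z.ep_t, h]) (by rw [lp_eq, lp_eq, hs])
  cases x; cases z
  simp only at h hm hp
  subst h hm hp
  rfl

theorem rectEq_iff (hL : IsLGBS L) {x z : Config L} {p q : ℤ} :
    RectEq x z p q ↔ (∀ (k : ℤ) (n : ℕ), k ≤ p → q ≤ k + n + 1 → x.v k n = z.v k n) ∧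
      (∀ k, k ≤ p → configSeq x k = configSeq z k) ∧
      (∀ k, q ≤ k → configSeq x k = configSeq z k) := by
  constructor
  · intro h
    refine ⟨fun k n h1 h2 => (h k n h1 h2).1, fun k hk => ?_, fun k hk => ?_⟩
    · rw [← lm_eq x k (q - k).toNat, ← lm_eq z k (q - k).toNat,
        (h k (q - k).toNat hk (by omega)).2.1]
    · have e : min p (k - 1) + ((k - 1 - min p (k - 1)).toNat : ℤ) + 1 = k := by omega
      have hx := lp_eq x (min p (k - 1)) (k - 1 - min p (k - 1)).toNat
      have hz := lp_eq z (min p (k - 1)) (k - 1 - min p (k - 1)).toNat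
      rw [e] at hx hz
      rw [← hx, ← hz, (h _ _ (min_le_left _ _) (by omega)).2.2]
  · rintro ⟨h1, h2, h3⟩ k n hk hn
    refine ⟨h1 k n hk hn, ?_, ?_⟩
    · refine hL.rightResolving n _ _ ?_ ?_
      · rw [x.em_s, z.em_s]
        exact h1 _ _ (by omega) (by push_cast; omega)
      · rw [lm_eq, lm_eq, h2 k hk]
    · refine hL.leftResolving n _ _ ?_ ?_
      · rw [x.ep_t, z.ep_t]
        exact h1 _ _ hk (by push_cast; omega)
      · rw [lp_eq, lp_eq, h3 _ hn]

theorem RectEq_symm {x z : Config L} {p q : ℤ} (h : RectEq x z p q) : RectEq z x p q :=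
  fun k n a b => ⟨(h k n a b).1.symm, (h k n a b).2.1.symm, (h k n a b).2.2.symm⟩

theorem RectEq_trans {x z w : Config L} {p q : ℤ} (h : RectEq x z p q) (h' : RectEq z w p q) :
    RectEq x w p q :=
  fun k n a b => ⟨(h k n a b).1.trans (h' k n a b).1, (h k n a b).2.1.trans (h' k n a b).2.1,
    (h k n a b).2.2.trans (h' k n a b).2.2⟩

theorem extend (hL : IsLGBS L) {x z : Config L} {P Q p q : ℤ} (h : RectEq x z P Q)
    (hp : ∀ k, P < k → k ≤ p → configSeq x k = configSeq z k)
    (hq : ∀ k, q ≤ k → k < Q → configSeq x k = configSeq z k) : RectEq x z p q := by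
  obtain ⟨h1, h2, h3⟩ := (rectEq_iff hL).1 h
  have hp' : ∀ k, k ≤ p → configSeq x k = configSeq z k := fun k hk => by
    rcases le_or_gt k P with h | h
    · exact h2 k h
    · exact hp k h hk
  have hq' : ∀ k, q ≤ k → configSeq x k = configSeq z k := fun k hk => by
    rcases le_or_gt Q k with h | h
    · exact h3 k h
    · exact hq k hk h
  have A1 : ∀ j : ℕ, ∀ (k : ℤ) (n : ℕ), k ≤ P + j → k ≤ p → Q ≤ k + n + 1 →
      x.v k n = z.v k n := by
    intro j
    induction j with
    | zero => intro k n a b c; exact h1 k n (by simpa using a) c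
    | succ j ih =>
      intro k n a b c
      have e1 := EM_of x k n
      have e2 := EM_of z k n
      rw [hp' k b, ih (k - 1) (n + 1) (by push_cast at a; omega) (by omega)
        (by push_cast; omega)] at e1
      exact e1.uniq hL e2
  have A2 : ∀ j : ℕ, ∀ (k : ℤ) (n : ℕ), k ≤ p → Q - j ≤ k + n + 1 → q ≤ k + n + 1 →
      x.v k n = z.v k n := by
    intro j
    induction j with
    | zero => intro k n a b c; exact A1 (k - P).toNat k n (by omega) a (by simpa using b)
    | succ j ih =>
      intro k n a b c
      have e1 := EP_of x k n
      have e2 := EP_of z k n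
      rw [hq' _ c, ih k (n + 1) a (by push_cast at b ⊢; omega) (by push_cast; omega)] at e1
      exact e1.uniq hL e2
  exact (rectEq_iff hL).2 ⟨fun k n a b => A2 (Q - (k + n + 1)).toNat k n a (by omega) b, hp', hq'⟩

theorem splice (hL : IsLGBS L) (x z : Config L) {p q : ℤ} (N : ℕ) (hN : p + N + 1 = q)
    (h : x.v p N = z.v p N) :
    ∃ w : Config L, RectEq w x p q ∧ ∀ k, p < k → k < q → configSeq w k = configSeq z k := by
  classical
  let y : ℤ → A := fun k => if p < k ∧ k < q then configSeq z k else configSeq x k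
  have yz : ∀ k, p < k → k < q → y k = configSeq z k := fun k a b => if_pos ⟨a, b⟩
  have y1 : ∀ k, k ≤ p → y k = configSeq x k := fun k a => if_neg (by omega)
  have y2 : ∀ k, q ≤ k → y k = configSeq x k := fun k a => if_neg (by omega)
  clear_value y
  let a : ∀ n, L.V n := fun n => if n ≤ N then z.v p n else x.v p n
  have a1 : ∀ n, n ≤ N → a n = z.v p n := fun n hn => if_pos hn
  have a2 : ∀ n, N ≤ n → a n = x.v p n := fun n hn => by
    rcases Nat.eq_or_lt_of_le hn with rfl | hn
    · rw [a1 _ le_rfl, h]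
    · exact if_neg (by omega)
  clear_value a
  have hRow : Row L y p a := by
    intro n
    rcases lt_or_ge n N with hn | hn
    · rw [a1 n hn.le, a1 (n + 1) hn, yz _ (by omega) (by omega)]
      exact EP_of z p n
    · rw [a2 n hn, a2 (n + 1) (by omega), y2 _ (by omega)]
      exact EP_of x p n
  obtain ⟨f, f0, f1, f2⟩ := int_choice
    (fun k v => Row L y k v ∧ (k ≤ p → ∀ n : ℕ, q ≤ k + n + 1 → v n = x.v k n))
    (fun k v' v => Link L y k v' v) p a ⟨hRow, fun _ n hn => a2 n (by omega)⟩
    (by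
      rintro k hk v ⟨hv, -⟩
      obtain ⟨v', b1, b2⟩ := row_up hL hv
      exact ⟨v', ⟨b1, fun h => by omega⟩, b2⟩)
    (by
      rintro k hk v ⟨hv, hv'⟩
      obtain ⟨v', b1, b2, b3⟩ := row_down hL hv (q - k).toNat (fun n => x.v (k - 1) n)
        (by
          intro n hn
          rw [y2 _ (by omega)]
          exact EP_of x (k - 1) n)
        (by
          intro n hn
          rw [y1 _ hk, hv' hk n (by omega)]
          exact EM_of x k n)
      exact ⟨v', ⟨b1, fun h n hn => b3 n (by omega)⟩, b2⟩)
  obtain ⟨w, hw, hs⟩ := exists_config y f (fun k => (f1 k).1) f2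
  refine ⟨w, (rectEq_iff hL).2 ⟨?_, ?_, ?_⟩, ?_⟩
  · intro k n b c
    rw [hw]; exact (f1 k).2 b n c
  · intro k b; rw [hs, y1 k b]
  · intro k b; rw [hs, y2 k b]
  · intro k b c; rw [hs, yz k b c]

/-! ### Topology -/

instance discV (L : LambdaGraphBisystem A) (n : ℕ) : TopologicalSpace (L.V n) := ⊥

instance discV' (L : LambdaGraphBisystem A) (n : ℕ) : DiscreteTopology (L.V n) := ⟨rfl⟩

instance finV (L : LambdaGraphBisystem A) (n : ℕ) : Finite (L.V n) :=
  @Finite.of_fintype _ (L.fintypeV n)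

theorem Pword_mem (x : Config L) (p : ℤ) (n : ℕ) : Pword x p n ∈ L.Pset n (x.v p n) := by
  induction n with
  | zero => simp [Pword, LambdaGraphBisystem.Pset]
  | succ n ih =>
    exact ⟨x.ep p n, x.ep_t p n, Pword x p n, by rw [x.ep_s]; exact ih, rfl⟩

theorem isOpen_Cyl (p : ℤ) (n : ℕ) (v : L.V n) (μ : List A) : IsOpen (Cyl p n v μ) := by
  by_cases h : μ ∈ L.Pset n v
  · exact TopologicalSpace.isOpen_generateFrom_of_mem ⟨p, n, v, μ, h, rfl⟩
  · convert isOpen_empty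
    ext x
    simp only [Cyl, Set.mem_ofPred_eq, Set.mem_empty_iff_false, iff_false]
    rintro ⟨rfl, rfl⟩
    exact h (Pword_mem x p n)

theorem continuous_v (p : ℤ) (n : ℕ) : Continuous (fun x : Config L => x.v p n) := by
  rw [continuous_discrete_rng]
  intro v
  have : (fun x : Config L => x.v p n) ⁻¹' {v} = ⋃ μ, Cyl p n v μ := by
    ext x; simp [Cyl]
  rw [this]
  exact isOpen_iUnion fun μ => isOpen_Cyl _ _ _ _

variable [TopologicalSpace A] [DiscreteTopology A]

theorem continuous_seq (k : ℤ) : Continuous (fun x : Config L => configSeq x k) := by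
  rw [continuous_discrete_rng]
  intro a
  have : (fun x : Config L => configSeq x k) ⁻¹' {a} = ⋃ v, Cyl (k - 1) 1 v [a] := by
    ext x; simp [Cyl, Pword, lp_eq]
  rw [this]
  exact isOpen_iUnion fun μ => isOpen_Cyl _ _ _ _

/-- The coordinates of a configuration. -/
def Phi (L : LambdaGraphBisystem A) (x : Config L) : (ℤ → ∀ n, L.V n) × (ℤ → A) :=
  (x.v, configSeq x)

theorem continuous_Phi : Continuous (Phi L) :=
  (continuous_pi fun k => continuous_pi fun n => continuous_v k n).prodMk
    (continuous_pi fun k => continuous_seq k)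

theorem isOpen_Pword (p : ℤ) (n : ℕ) : ∀ μ : List A,
    IsOpen[TopologicalSpace.induced (Phi L) inferInstance] {x : Config L | Pword x p n = μ} := by
  let _ : TopologicalSpace (Config L) := TopologicalSpace.induced (Phi L) inferInstance
  have hc : Continuous (Phi L) := continuous_induced_dom
  have hs : ∀ k, Continuous (fun x : Config L => configSeq x k) := fun k =>
    (continuous_apply k).comp (continuous_snd.comp hc)
  induction n with
  | zero => intro μ; exact (isOpen_const : IsOpen {_x : Config L | ([] : List A) = μ})
  | succ n ih =>
    intro μ
    have : {x : Config L | Pword x p (n + 1) = μ} =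
        ⋃ (μ' : List A) (a : A) (_ : μ = μ' ++ [a]), {x : Config L | Pword x p n = μ'} ∩
          {x : Config L | configSeq x (p + n + 1) = a} := by
      ext x
      simp only [Pword, lp_eq, Set.mem_ofPred_eq, Set.mem_iUnion, Set.mem_inter_iff]
      constructor
      · intro h; exact ⟨_, _, h.symm, rfl, rfl⟩
      · rintro ⟨_, _, rfl, rfl, rfl⟩; rfl
    rw [this]
    refine isOpen_iUnion fun μ' => isOpen_iUnion fun a => isOpen_iUnion fun _ => ?_
    exact (ih μ').inter ((isOpen_discrete {a}).preimage (hs _))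

theorem isEmbedding_Phi (hL : IsLGBS L) : Topology.IsEmbedding (Phi L) := by
  refine ⟨⟨le_antisymm continuous_Phi.le_induced ?_⟩, ?_⟩
  · refine le_generateFrom ?_
    rintro _ ⟨p, n, v, μ, -, rfl⟩
    let _ : TopologicalSpace (Config L) := TopologicalSpace.induced (Phi L) inferInstance
    have hc : Continuous (Phi L) := continuous_induced_dom
    have hv : Continuous (fun x : Config L => x.v p n) :=
      (continuous_apply n).comp ((continuous_apply p).comp (continuous_fst.comp hc))
    exact ((isOpen_discrete {v}).preimage hv).inter (isOpen_Pword p n μ)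
  · intro x z h
    exact config_ext hL (congrArg Prod.fst h) (congrArg Prod.snd h)

theorem isClosed_range : IsClosed (Set.range (Phi L)) := by
  have : Set.range (Phi L) = ⋂ (k : ℤ) (n : ℕ),
      {f : (ℤ → ∀ n, L.V n) × (ℤ → A) |
        EP L n (f.2 (k + n + 1)) (f.1 k n) (f.1 k (n + 1)) ∧
        EM L n (f.2 k) (f.1 (k - 1) (n + 1)) (f.1 k n)} := by
    ext f
    simp only [Set.mem_range, Set.mem_iInter, Set.mem_ofPred_eq]
    constructor
    · rintro ⟨x, rfl⟩ k n
      exact ⟨EP_of x k n, EM_of x k n⟩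
    · intro h
      obtain ⟨x, h1, h2⟩ := exists_config f.2 f.1 (fun k n => (h k n).1) (fun k n => (h k n).2)
      exact ⟨x, Prod.ext h1 h2⟩
  rw [this]
  refine isClosed_iInter fun k => isClosed_iInter fun n => ?_
  have cv : ∀ k n, Continuous (fun f : (ℤ → ∀ n, L.V n) × (ℤ → A) => f.1 k n) := fun k n =>
    (continuous_apply n).comp ((continuous_apply k).comp continuous_fst)
  have cs : ∀ k, Continuous (fun f : (ℤ → ∀ n, L.V n) × (ℤ → A) => f.2 k) := fun k =>
    (continuous_apply k).comp continuous_snd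
  have c1 := (cs (k + n + 1)).prodMk ((cv k n).prodMk (cv k (n + 1)))
  have c2 := (cs k).prodMk ((cv (k - 1) (n + 1)).prodMk (cv k n))
  exact ((isClosed_discrete {t : A × L.V n × L.V (n + 1) | EP L n t.1 t.2.1 t.2.2}).preimage
    c1).inter
    ((isClosed_discrete {t : A × L.V (n + 1) × L.V n | EM L n t.1 t.2.1 t.2.2}).preimage c2)

theorem compact_config [Finite A] (hL : IsLGBS L) : CompactSpace (Config L) :=
  (Topology.IsClosedEmbedding.mk (isEmbedding_Phi hL) isClosed_range).compactSpace

theorem t2_config (hL : IsLGBS L) : T2Space (Config L) :=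
  (isEmbedding_Phi hL).t2Space

theorem isClosed_Rpq (hL : IsLGBS L) (p q : ℤ) : IsClosed (RpqSet L p q) := by
  have : RpqSet L p q = {xz : Config L × Config L |
      (∀ (k : ℤ) (n : ℕ), k ≤ p → q ≤ k + n + 1 → xz.1.v k n = xz.2.v k n) ∧
      (∀ k, k ≤ p → configSeq xz.1 k = configSeq xz.2 k) ∧
      (∀ k, q ≤ k → configSeq xz.1 k = configSeq xz.2 k)} := by
    ext xz
    exact rectEq_iff hL
  rw [this]
  simp only [Set.ofPred_and, Set.ofPred_forall]
  refine IsClosed.inter ?_ (IsClosed.inter ?_ ?_)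
  · refine isClosed_iInter fun k => isClosed_iInter fun n => isClosed_iInter fun _ =>
      isClosed_iInter fun _ => ?_
    exact isClosed_eq ((continuous_v k n).comp continuous_fst)
      ((continuous_v k n).comp continuous_snd)
  · refine isClosed_iInter fun k => isClosed_iInter fun _ => ?_
    exact isClosed_eq ((continuous_seq k).comp continuous_fst)
      ((continuous_seq k).comp continuous_snd)
  · refine isClosed_iInter fun k => isClosed_iInter fun _ => ?_
    exact isClosed_eq ((continuous_seq k).comp continuous_fst)
      ((continuous_seq k).comp continuous_snd)

instance instRset (L : LambdaGraphBisystem A) : TopologicalSpace ↥(Rset L) := indTop L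

theorem continuous_R_iff {Y : Type*} [TopologicalSpace Y] (f : ↥(Rset L) → Y) :
    Continuous[indTop L, _] f ↔ ∀ p q h, Continuous (f ∘ inclPQ L p q h) := by
  unfold indTop
  simp only [continuous_iSup_dom, continuous_coinduced_dom]

theorem isOpen_R_iff (S : Set ↥(Rset L)) :
    IsOpen[indTop L] S ↔ ∀ p q h, IsOpen (inclPQ L p q h ⁻¹' S) := by
  unfold indTop
  simp only [isOpen_iSup_iff, isOpen_coinduced]

theorem isOpen_Rpq (hL : IsLGBS L) (p q : ℤ) :
    IsOpen[indTop L] {y : ↥(Rset L) | y.val ∈ RpqSet L p q} := by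
  rw [isOpen_R_iff]
  intro p' q' h
  have : inclPQ L p' q' h ⁻¹' {y : ↥(Rset L) | y.val ∈ RpqSet L p q} =
      (⋂ k ∈ Set.Ioc p' p, {y : ↥(RpqSet L p' q') | configSeq y.1.1 k = configSeq y.1.2 k}) ∩
      (⋂ k ∈ Set.Ico q q', {y : ↥(RpqSet L p' q') | configSeq y.1.1 k = configSeq y.1.2 k}) := by
    ext ⟨y, hy⟩
    simp only [Set.mem_preimage, Set.mem_ofPred_eq, Set.mem_inter_iff, Set.mem_iInter, inclPQ]
    constructor
    · intro h
      have h := (rectEq_iff hL).1 h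
      exact ⟨fun k hk => h.2.1 k hk.2, fun k hk => h.2.2 k hk.1⟩
    · rintro ⟨h1, h2⟩
      exact extend hL hy (fun k a b => h1 k ⟨a, b⟩) (fun k a b => h2 k ⟨a, b⟩)
  rw [this]
  have key : ∀ k, IsOpen {y : ↥(RpqSet L p' q') | configSeq y.1.1 k = configSeq y.1.2 k} := by
    intro k
    have c : Continuous fun y : ↥(RpqSet L p' q') => (configSeq y.1.1 k, configSeq y.1.2 k) :=
      ((continuous_seq k).comp (continuous_fst.comp continuous_subtype_val)).prodMk
      ((continuous_seq k).comp (continuous_snd.comp continuous_subtype_val))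
    exact (isOpen_discrete {t : A × A | t.1 = t.2}).preimage c
  exact ((Set.finite_Ioc _ _).isOpen_biInter fun k _ => key k).inter
    ((Set.finite_Ico _ _).isOpen_biInter fun k _ => key k)

theorem isCompact_Rpq [Finite A] (hL : IsLGBS L) (p q : ℤ) (h : p < q) :
    @IsCompact _ (indTop L) {y : ↥(Rset L) | y.val ∈ RpqSet L p q} := by
  have := compact_config hL
  have := isCompact_iff_compactSpace.1 (isClosed_Rpq hL p q).isCompact
  have hc : Continuous (inclPQ L p q h) :=
    (continuous_R_iff (L := L) id).1 continuous_id p q h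
  have e : {y : ↥(Rset L) | y.val ∈ RpqSet L p q} = Set.range (inclPQ L p q h) := by
    ext y
    constructor
    · intro hy; exact ⟨⟨y.1, hy⟩, rfl⟩
    · rintro ⟨y, rfl⟩; exact y.2
  rw [e]
  exact isCompact_range hc

theorem continuous_val : Continuous (fun y : ↥(Rset L) => y.val) :=
  (continuous_R_iff _).2 fun _ _ _ => continuous_subtype_val

theorem localHomeo_fst [Finite A] (hL : IsLGBS L) :
    IsLocalHomeomorph (fun y : ↥(Rset L) => y.val.1) := by
  rw [isLocalHomeomorph_iff_isOpenEmbedding_restrict]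
  rintro ⟨⟨x, z⟩, p, q, hpq, hxz⟩
  obtain ⟨N, hN⟩ : ∃ N : ℕ, p + N + 1 = q := ⟨(q - p - 1).toNat, by omega⟩
  let B : Set ↥(Rset L) := {y | y.val.1.v p N = x.v p N} ∩
    ⋂ k ∈ Set.Ioo p q, {y | configSeq y.val.2 k = configSeq z k}
  have cv : Continuous fun y : ↥(Rset L) => y.val.1.v p N :=
    (continuous_v p N).comp (continuous_fst.comp continuous_val)
  have cs : ∀ k, Continuous fun y : ↥(Rset L) => configSeq y.val.2 k := fun k =>
    (continuous_seq k).comp (continuous_snd.comp continuous_val)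
  have hBo : IsOpen B := ((isOpen_discrete {x.v p N}).preimage cv).inter
    ((Set.finite_Ioo _ _).isOpen_biInter fun k _ =>
      (isOpen_discrete {configSeq z k}).preimage (cs k))
  have hBc : IsClosed B := ((isClosed_discrete {x.v p N}).preimage cv).inter
    (isClosed_biInter fun k _ => (isClosed_discrete {configSeq z k}).preimage (cs k))
  let U : Set ↥(Rset L) := {y | y.val ∈ RpqSet L p q} ∩ B
  have hUo : IsOpen U := (isOpen_Rpq hL p q).inter hBo
  have hUc : IsCompact U := (isCompact_Rpq hL p q hpq).inter_right hBc
  have hvx : x.v p N = z.v p N := (hxz p N le_rfl (by omega)).1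
  refine ⟨U, hUo.mem_nhds ⟨hxz, rfl, by simp⟩, ?_⟩
  have : CompactSpace U := isCompact_iff_compactSpace.1 hUc
  have := t2_config hL
  have hc : Continuous (U.domRestrict fun y : ↥(Rset L) => y.val.1) :=
    (continuous_fst.comp continuous_val).comp continuous_subtype_val
  have hinj : Function.Injective (U.domRestrict fun y : ↥(Rset L) => y.val.1) := by
    rintro ⟨⟨⟨x1, z1⟩, r1⟩, h1, h1', h1''⟩ ⟨⟨⟨x2, z2⟩, r2⟩, h2, h2', h2''⟩ h
    have h : x1 = x2 := h
    subst h
    have g1 : ∀ k ∈ Set.Ioo p q, configSeq z1 k = configSeq z k := Set.mem_iInter₂.1 h1''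
    have g2 : ∀ k ∈ Set.Ioo p q, configSeq z2 k = configSeq z k := Set.mem_iInter₂.1 h2''
    have hr : RectEq z1 z2 p q := RectEq_trans (RectEq_symm h1) h2
    have hr' := (rectEq_iff hL).1 hr
    have hs : ∀ k, configSeq z1 k = configSeq z2 k := by
      intro k
      rcases le_or_gt k p with hk | hk
      · exact hr'.2.1 k hk
      rcases le_or_gt q k with hk' | hk'
      · exact hr'.2.2 k hk'
      · rw [g1 k ⟨hk, hk'⟩, g2 k ⟨hk, hk'⟩]
    have : z1 = z2 := by
      refine config_ext hL ?_ (funext hs)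
      funext k n
      have := extend hL (p := k) (q := k + n + 1) hr (fun k _ _ => hs k) (fun k _ _ => hs k)
      exact (this k n le_rfl le_rfl).1
    subst this
    rfl
  have hrange : Set.range (U.domRestrict fun y : ↥(Rset L) => y.val.1) =
      {x' | x'.v p N = x.v p N} := by
    ext x'
    constructor
    · rintro ⟨⟨y, hy⟩, rfl⟩
      exact hy.2.1
    · intro hx'
      obtain ⟨w, w1, w2⟩ := splice hL x' z N hN (Eq.trans hx' hvx)
      refine ⟨⟨⟨(x', w), p, q, hpq, RectEq_symm w1⟩, RectEq_symm w1, hx', ?_⟩, rfl⟩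
      simp only [Set.mem_iInter, Set.mem_ofPred_eq]
      exact fun k hk => w2 k hk.1 hk.2
  exact ⟨(hc.isClosedEmbedding hinj).isEmbedding, by
    rw [hrange]
    exact (isOpen_discrete {x.v p N}).preimage (continuous_v p N)⟩

/-- The flip on `R_L`. -/
def flip (L : LambdaGraphBisystem A) (y : ↥(Rset L)) : ↥(Rset L) :=
  ⟨(y.val.2, y.val.1), by
    obtain ⟨p, q, h, h'⟩ := y.2
    exact ⟨p, q, h, RectEq_symm h'⟩⟩

theorem continuous_flip : Continuous (flip L) := by
  refine (continuous_R_iff _).2 fun p q h => ?_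
  have hc : Continuous (inclPQ L p q h) :=
    (continuous_R_iff (L := L) id).1 continuous_id p q h
  let s : ↥(RpqSet L p q) → ↥(RpqSet L p q) := fun y => ⟨(y.1.2, y.1.1), RectEq_symm y.2⟩
  have hs : Continuous s := Continuous.subtype_mk
    ((continuous_snd.comp continuous_subtype_val).prodMk
      (continuous_fst.comp continuous_subtype_val)) _
  exact hc.comp hs

theorem localHomeo_snd [Finite A] (hL : IsLGBS L) :
    IsLocalHomeomorph (fun y : ↥(Rset L) => y.val.2) := by
  let e : ↥(Rset L) ≃ₜ ↥(Rset L) :=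
    { toFun := flip L, invFun := flip L, left_inv := fun _ => rfl, right_inv := fun _ => rfl,
      continuous_toFun := continuous_flip, continuous_invFun := continuous_flip }
  exact (localHomeo_fst hL).comp e.isLocalHomeomorph

end LGB

/-- Each `R_{L,(p,q)}` is a compact open subset of `R_L`; the family is
monotone: `R_{L,(p,q)} ⊆ R_{L,(p',q')}` whenever `p' ≤ p` and `q ≤ q'`; `R_L` is their
union; and the source and range maps are local homeomorphisms, so `R_L` is an étale AF
equivalence relation. -/
theorem Rrel_etale_AF {A : Type} [Fintype A]
    (L : LambdaGraphBisystem A) (hL : IsLGBS L) :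
    (∀ p q : ℤ, p < q →
        @IsCompact ↥(Rset L) (indTop L) {y : ↥(Rset L) | y.val ∈ RpqSet L p q} ∧
        @IsOpen ↥(Rset L) (indTop L) {y : ↥(Rset L) | y.val ∈ RpqSet L p q}) ∧
    (∀ p q p' q' : ℤ, p' ≤ p → q ≤ q' → RpqSet L p q ⊆ RpqSet L p' q') ∧
    (Rset L = ⋃ (p : ℤ) (q : ℤ) (_ : p < q), RpqSet L p q) ∧
    @IsLocalHomeomorph _ _ (indTop L) _ (fun y : ↥(Rset L) => y.val.2) ∧
    @IsLocalHomeomorph _ _ (indTop L) _ (fun y : ↥(Rset L) => y.val.1) := by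
  letI : TopologicalSpace A := ⊥
  haveI : DiscreteTopology A := ⟨rfl⟩
  refine ⟨fun p q h => ⟨LGB.isCompact_Rpq hL p q h, LGB.isOpen_Rpq hL p q⟩, ?_, ?_,
    LGB.localHomeo_snd hL, LGB.localHomeo_fst hL⟩
  · intro p q p' q' hp hq xz h k n hk hn
    exact h k n (hk.trans hp) (hq.trans hn)
  · ext xz
    simp only [Set.mem_iUnion]
    constructor
    · rintro ⟨p, q, h, h'⟩
      exact ⟨p, q, h, h'⟩
    · rintro ⟨p, q, h, h'⟩
      exact ⟨p, q, h, h'⟩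
end

section
/- Suppose two-sided subshifts Λ₁ and Λ₂ over finite alphabets are topologically conjugate via a homeomorphism h_Λ : Λ₁ → Λ₂. Then there exists a homeomorphism h : X_{Λ₁} → X_{Λ₂} of the associated configuration spaces such that: (i) h_Λ ∘ π₁ = π₂ ∘ h, where π_i : X_{Λ_i} → Λ_i are the factor maps; (ii) h ∘ σ_{X_{Λ₁}} = σ_{X_{Λ₂}} ∘ h; (iii) (h × h)(R_{Λ₁}) = R_{Λ₂}; (iv) h × h : R_{Λ₁} → R_{Λ₂} is a homeomorphism with respect to the inductive limit topologies on the étale equivalence relations R_{Λ₁} and R_{Λ₂}. -/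
variable {A : Type}

/-! ## Subshifts and the canonical λ-graph bisystem -/

/-- The product topology on `ℤ → A` with `A` discrete. -/
def seqTop (A : Type) : TopologicalSpace (ℤ → A) :=
  @Pi.topologicalSpace ℤ (fun _ => A) (fun _ => ⊥)

/-- A two-sided subshift over the alphabet `A`. -/
structure Subshift (A : Type) where
  carrier : Set (ℤ → A)
  nonempty : carrier.Nonempty
  closed : @IsClosed (ℤ → A) (seqTop A) carrier
  shiftInv : ∀ a : ℤ → A, a ∈ carrier ↔ (fun n => a (n + 1)) ∈ carrier

/-- The subspace topology on a subshift. -/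
def subTop (S : Subshift A) : TopologicalSpace {a // a ∈ S.carrier} :=
  TopologicalSpace.induced Subtype.val (seqTop A)

/-- The shift homeomorphism on a subshift. -/
def Subshift.shiftMap (S : Subshift A) (a : {a // a ∈ S.carrier}) : {a // a ∈ S.carrier} :=
  ⟨fun n => a.val (n + 1), (S.shiftInv a.val).1 a.prop⟩

/-- A topological conjugacy between two subshifts. -/
structure Conjugacy {A₁ A₂ : Type} (S₁ : Subshift A₁) (S₂ : Subshift A₂) where
  toFun : {a // a ∈ S₁.carrier} → {b // b ∈ S₂.carrier}
  invFun : {b // b ∈ S₂.carrier} → {a // a ∈ S₁.carrier}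
  left_inv : Function.LeftInverse invFun toFun
  right_inv : Function.RightInverse invFun toFun
  continuous_toFun : @Continuous _ _ (subTop S₁) (subTop S₂) toFun
  continuous_invFun : @Continuous _ _ (subTop S₂) (subTop S₁) invFun
  equivariant : ∀ a, toFun (S₁.shiftMap a) = S₂.shiftMap (toFun a)

/-- `splice x l w` replaces the entries of `x` at positions `-l+1, …, 0` by the word `w`. -/
def splice (x : ℤ → A) (l : ℕ) (w : Fin l → A) : ℤ → A :=
  fun i => if h : -(l : ℤ) + 1 ≤ i ∧ i ≤ 0 then w ⟨(i + l - 1).toNat, by omega⟩ else x i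

/-- The set `W_{-l,1}(x)` of `(-l,1)`-central words of `x`. -/
def Wset (S : Subshift A) (l : ℕ) (x : ℤ → A) : Set (Fin l → A) :=
  {w | splice x l w ∈ S.carrier}

/-- `(-l,1)`-central equivalence. -/
def centralSetoid (S : Subshift A) (l : ℕ) : Setoid {a // a ∈ S.carrier} where
  r x z := Wset S l x.val = Wset S l z.val
  iseqv := ⟨fun _ => rfl, Eq.symm, Eq.trans⟩

/-- The vertex set `V_l = Ω_{-l,1}` of the canonical λ-graph bisystem. -/
def Vcan (S : Subshift A) (l : ℕ) : Type := Quotient (centralSetoid S l)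

noncomputable def VcanFintype [Fintype A] (S : Subshift A) (l : ℕ) : Fintype (Vcan S l) := by
  classical
  have : Fintype (Set (Fin l → A)) := Fintype.ofFinite _
  exact Fintype.ofInjective
    (Quotient.lift (fun x : {a // a ∈ S.carrier} => Wset S l x.val) (fun _ _ h => h))
    (fun a b => Quotient.inductionOn₂ a b (fun _ _ h => Quotient.sound h))

/-- The edge set `E⁻_{l+1,l}` of the canonical λ-graph bisystem: there is an edge labeled
`β` from the class of `x` in `V_{l+1}` to the class of the point obtained from `x` by
inserting `β` at the left end of the central window. -/
def EmCan (S : Subshift A) (l : ℕ) : Type :=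
  {t : Vcan S (l + 1) × A × Vcan S l //
    ∃ x : {a // a ∈ S.carrier}, Quotient.mk (centralSetoid S (l + 1)) x = t.1 ∧
      ∃ w : Fin (l + 1) → A, w ⟨0, Nat.succ_pos l⟩ = t.2.1 ∧
        ∃ h : splice x.val (l + 1) w ∈ S.carrier,
          Quotient.mk (centralSetoid S l) ⟨splice x.val (l + 1) w, h⟩ = t.2.2}

/-- The inverse shift `σ⁻¹` on sequences. -/
def shiftR (a : ℤ → A) : ℤ → A := fun n => a (n - 1)

/-- The edge set `E⁺_{l,l+1}` of the canonical λ-graph bisystem: there is an edge labeled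
`α` ending at the class of `x` in `V_{l+1}` whose source is the class (in `V_l`, after
the canonical shift identification) of the point obtained from `x` by inserting `α` at
the right end of the central window. -/
def EpCan (S : Subshift A) (l : ℕ) : Type :=
  {t : Vcan S l × A × Vcan S (l + 1) //
    ∃ x : {a // a ∈ S.carrier}, Quotient.mk (centralSetoid S (l + 1)) x = t.2.2 ∧
      ∃ w : Fin (l + 1) → A, w ⟨l, Nat.lt_succ_self l⟩ = t.2.1 ∧
        ∃ h : shiftR (splice x.val (l + 1) w) ∈ S.carrier,
          Quotient.mk (centralSetoid S l) ⟨shiftR (splice x.val (l + 1) w), h⟩ = t.1}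

/-- The canonical λ-graph bisystem `L_Λ` of a subshift `Λ`. -/
noncomputable def canonicalLGBS [Fintype A] (S : Subshift A) : LambdaGraphBisystem A where
  V := Vcan S
  Em := EmCan S
  Ep := EpCan S
  fintypeV := fun l => VcanFintype S l
  nonemptyV := fun l => ⟨Quotient.mk _ ⟨S.nonempty.choose, S.nonempty.choose_spec⟩⟩
  fintypeEm := fun l => by
    classical
    haveI := VcanFintype S (l + 1); haveI := VcanFintype S l
    unfold EmCan
    exact Fintype.ofFinite _
  fintypeEp := fun l => by
    classical
    haveI := VcanFintype S (l + 1); haveI := VcanFintype S l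
    unfold EpCan
    exact Fintype.ofFinite _
  sm := fun _ e => e.val.1
  tm := fun _ e => e.val.2.2
  lm := fun _ e => e.val.2.1
  sp := fun _ e => e.val.1
  tp := fun _ e => e.val.2.2
  lp := fun _ e => e.val.2.1

/-! ## Proof -/

theorem Subshift.mem_shift (S : Subshift A) (m : ℤ) : ∀ a : ℤ → A,
    a ∈ S.carrier ↔ (fun i => a (i + m)) ∈ S.carrier := by
  induction m using Int.induction_on with
  | zero => intro a; simp
  | succ n ih =>
    intro a
    rw [ih a, S.shiftInv]
    have : (fun i : ℤ => a (i + 1 + n)) = fun i => a (i + (n + 1)) := by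
      funext i; congr 1; ring
    rw [this]
  | pred n ih =>
    intro a
    rw [S.shiftInv (fun i => a (i + (-(n:ℤ) - 1))), ih a]
    have : (fun i : ℤ => a (i + 1 + (-(n:ℤ) - 1))) = fun i => a (i + (-n)) := by
      funext i; congr 1; ring
    rw [this]

def glue (p q : ℤ) (w y : ℤ → A) : ℤ → A := fun i => if p < i ∧ i < q then w i else y i

def Wv (S : Subshift A) {n : ℕ} (v : Vcan S n) : Set (Fin n → A) :=
  Quotient.lift (fun x : {a // a ∈ S.carrier} => Wset S n x.val) (fun _ _ h => h) v

def InW (S : Subshift A) {n : ℕ} (v : Vcan S n) (k : ℤ) (w : ℤ → A) : Prop :=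
  (fun j : Fin n => w (k + 1 + (j : ℕ))) ∈ Wv S v

theorem inW_mk (S : Subshift A) {n : ℕ} (a : {a // a ∈ S.carrier}) (k : ℤ) (w : ℤ → A) :
    InW S (Quotient.mk (centralSetoid S n) a) k w ↔
      splice a.val n (fun j : Fin n => w (k + 1 + (j : ℕ))) ∈ S.carrier := Iff.rfl

theorem inW_congr (S : Subshift A) {n : ℕ} (v : Vcan S n) (k : ℤ) {w w' : ℤ → A}
    (h : ∀ i, k < i → i < k + n + 1 → w i = w' i) : InW S v k w ↔ InW S v k w' := by
  unfold InW
  have : (fun j : Fin n => w (k + 1 + (j : ℕ))) = (fun j : Fin n => w' (k + 1 + (j : ℕ))) := by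
    funext j
    exact h _ (by omega) (by omega)
  rw [this]

theorem inW_ext (S : Subshift A) {n : ℕ} {v v' : Vcan S n} (k : ℤ)
    (h : ∀ w, InW S v k w ↔ InW S v' k w) : v = v' := by
  have key : Wv S v = Wv S v' := by
    ext u
    obtain ⟨y, -⟩ := S.nonempty
    have := h (fun i => if hh : k < i ∧ i < k + n + 1 then u ⟨(i - k - 1).toNat, by omega⟩ else y i)
    unfold InW at this
    have e : (fun j : Fin n => (fun i => if hh : k < i ∧ i < k + n + 1 then
        u ⟨(i - k - 1).toNat, by omega⟩ else y i) (k + 1 + (j : ℕ))) = u := by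
      funext j
      have hj : k < k + 1 + (j:ℕ) ∧ k + 1 + (j:ℕ) < k + n + 1 := by omega
      simp only [hj, and_self, dite_true]
      congr 1
      apply Fin.ext
      simp
      omega
    rwa [e] at this
  induction v using Quotient.inductionOn
  induction v' using Quotient.inductionOn
  exact Quotient.sound key

/-- The class of `y` at the window `(k, k+n+1)`. -/
def cls (S : Subshift A) (y : {a // a ∈ S.carrier}) (k : ℤ) (n : ℕ) : Vcan S n :=
  Quotient.mk (centralSetoid S n) ⟨fun i => y.val (i + (k + n)), (S.mem_shift _ _).1 y.prop⟩

theorem inW_cls (S : Subshift A) (y : {a // a ∈ S.carrier}) (k : ℤ) (n : ℕ) (w : ℤ → A) :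
    InW S (cls S y k n) k w ↔ glue k (k + n + 1) w y.val ∈ S.carrier := by
  unfold cls
  rw [inW_mk, S.mem_shift (k + n) (glue k (k + n + 1) w y.val)]
  have : splice (fun i => y.val (i + (k + n))) n (fun j : Fin n => w (k + 1 + (j : ℕ))) =
      fun i => glue k (k + n + 1) w y.val (i + (k + n)) := by
    funext i
    unfold splice glue
    by_cases h : -(n : ℤ) + 1 ≤ i ∧ i ≤ 0
    · rw [dif_pos h, if_pos (by omega)]
      dsimp only
      congr 1
      omega
    · rw [dif_neg h, if_neg (by omega)]
  rw [this]

theorem cls_surj (S : Subshift A) (k : ℤ) {n : ℕ} (v : Vcan S n) : ∃ y, cls S y k n = v := by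
  induction v using Quotient.inductionOn with
  | h a =>
    refine ⟨⟨fun i => a.val (i + (-(k + n))), (S.mem_shift _ _).1 a.prop⟩, ?_⟩
    unfold cls
    congr 1
    apply Subtype.ext
    funext i
    ring_nf

theorem exists_inW (S : Subshift A) {n : ℕ} (v : Vcan S n) (k : ℤ) : ∃ w, InW S v k w := by
  obtain ⟨y, rfl⟩ := cls_surj S k v
  refine ⟨y.val, ?_⟩
  rw [inW_cls]
  have : glue k (k + n + 1) y.val y.val = y.val := by funext i; simp [glue]
  rw [this]; exact y.prop

theorem cls_congr (S : Subshift A) (y z : {a // a ∈ S.carrier}) (k : ℤ) (n : ℕ)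
    (h : ∀ i, i ≤ k ∨ k + n + 1 ≤ i → y.val i = z.val i) : cls S y k n = cls S z k n := by
  apply inW_ext S k
  intro w
  rw [inW_cls, inW_cls]
  have : glue k (k + n + 1) w y.val = glue k (k + n + 1) w z.val := by
    funext i
    unfold glue
    split_ifs with hh
    · rfl
    · exact h i (by omega)
  rw [this]

theorem inW_zero (S : Subshift A) (v : Vcan S 0) (k : ℤ) (w : ℤ → A) : InW S v k w := by
  obtain ⟨w', h⟩ := exists_inW S v k
  exact (inW_congr S v k (fun i h1 h2 => by simp at h2; omega)).1 h

theorem em_prop (S : Subshift A) {l : ℕ} (e : EmCan S l) (k : ℤ) (w : ℤ → A)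
    (hw : w k = e.val.2.1) : InW S e.val.2.2 k w ↔ InW S e.val.1 (k - 1) w := by
  obtain ⟨⟨s, β, t⟩, x, hs, w0, hβ, hm, ht⟩ := e
  dsimp only at *
  subst hs ht
  rw [inW_mk, inW_mk]
  have : splice (splice x.val (l + 1) w0) l (fun j : Fin l => w (k + 1 + (j : ℕ))) =
      splice x.val (l + 1) (fun j : Fin (l + 1) => w (k - 1 + 1 + (j : ℕ))) := by
    funext i
    unfold splice
    by_cases h : -(l : ℤ) + 1 ≤ i ∧ i ≤ 0
    · rw [dif_pos h, dif_pos (by omega)]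
      dsimp only
      congr 1
      omega
    · rw [dif_neg h]
      by_cases h' : i = -(l : ℤ)
      · subst h'
        rw [dif_pos (by omega), dif_pos (by omega)]
        have e0 : (⟨(-(l:ℤ) + ((l + 1 : ℕ) : ℤ) - 1).toNat, by omega⟩ : Fin (l + 1)) =
            ⟨0, Nat.succ_pos l⟩ := by
          apply Fin.ext; simp
        rw [e0, hβ, ← hw]
        congr 1
        simp
      · rw [dif_neg (by omega), dif_neg (by omega)]
  rw [this]

theorem ep_prop (S : Subshift A) {l : ℕ} (e : EpCan S l) (k : ℤ) (w : ℤ → A)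
    (hw : w (k + l + 1) = e.val.2.1) : InW S e.val.1 k w ↔ InW S e.val.2.2 k w := by
  obtain ⟨⟨s, β, t⟩, x, ht, w0, hβ, hm, hs⟩ := e
  dsimp only at *
  subst hs ht
  rw [inW_mk, inW_mk]
  rw [S.mem_shift (-1) (splice x.val (l + 1) (fun j : Fin (l + 1) => w (k + 1 + (j : ℕ))))]
  have : splice (shiftR (splice x.val (l + 1) w0)) l (fun j : Fin l => w (k + 1 + (j : ℕ))) =
      fun i => splice x.val (l + 1) (fun j : Fin (l + 1) => w (k + 1 + (j : ℕ))) (i + -1) := by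
    funext i
    unfold shiftR splice
    dsimp only
    by_cases h : -(l : ℤ) + 1 ≤ i ∧ i ≤ 0
    · rw [dif_pos h, dif_pos (by omega)]
      congr 1
      omega
    · rw [dif_neg h]
      by_cases h' : i = 1
      · subst h'
        rw [dif_pos (by omega), dif_pos (by omega)]
        have e0 : (⟨((1:ℤ) - 1 + ((l + 1 : ℕ) : ℤ) - 1).toNat, by omega⟩ : Fin (l + 1)) =
            ⟨l, Nat.lt_succ_self l⟩ := by
          apply Fin.ext; simp
        rw [e0, hβ, ← hw]
        congr 1
        simp
        ring_nf
      · rw [dif_neg (by omega), dif_neg (by omega)]; rfl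
  rw [this]

theorem em_exists (S : Subshift A) {l : ℕ} (s : Vcan S (l + 1)) (β : A) (t : Vcan S l) (k : ℤ)
    (h : ∀ w : ℤ → A, w k = β → (InW S t k w ↔ InW S s (k - 1) w)) :
    ∃ x : {a // a ∈ S.carrier}, Quotient.mk (centralSetoid S (l + 1)) x = s ∧
      ∃ w : Fin (l + 1) → A, w ⟨0, Nat.succ_pos l⟩ = β ∧
        ∃ h : splice x.val (l + 1) w ∈ S.carrier,
          Quotient.mk (centralSetoid S l) ⟨splice x.val (l + 1) w, h⟩ = t := by
  obtain ⟨w, hw⟩ := exists_inW S t k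
  have hc : ∀ w v, InW S v k w ↔ InW S (n := l) v k (Function.update w k β) := fun w v =>
    inW_congr S v k (fun i h1 h2 => by rw [Function.update_of_ne (by omega)])
  rw [hc, h _ (by simp)] at hw
  obtain ⟨x, rfl⟩ := Quotient.exists_rep s
  have hw' := hw
  rw [inW_mk] at hw'
  refine ⟨x, rfl, _, ?_, hw', ?_⟩
  · simp
  · apply inW_ext S k
    intro w1
    refine (hc w1 _).trans (Iff.trans ?_ ((hc w1 t).trans (h _ (by simp))).symm)
    exact em_prop S (l := l) ⟨(_, β, _), x, rfl, _, by simp, hw', rfl⟩ k _ (by simp)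

theorem ep_exists (S : Subshift A) {l : ℕ} (s : Vcan S l) (β : A) (t : Vcan S (l + 1)) (k : ℤ)
    (h : ∀ w : ℤ → A, w (k + l + 1) = β → (InW S s k w ↔ InW S t k w)) :
    ∃ x : {a // a ∈ S.carrier}, Quotient.mk (centralSetoid S (l + 1)) x = t ∧
      ∃ w : Fin (l + 1) → A, w ⟨l, Nat.lt_succ_self l⟩ = β ∧
        ∃ h : shiftR (splice x.val (l + 1) w) ∈ S.carrier,
          Quotient.mk (centralSetoid S l) ⟨shiftR (splice x.val (l + 1) w), h⟩ = s := by
  obtain ⟨w, hw⟩ := exists_inW S s k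
  have hc : ∀ w v, InW S v k w ↔ InW S (n := l) v k (Function.update w (k + l + 1) β) :=
    fun w v => inW_congr S v k (fun i h1 h2 => by rw [Function.update_of_ne (by omega)])
  rw [hc, h _ (by simp)] at hw
  obtain ⟨x, rfl⟩ := Quotient.exists_rep t
  have hw' := hw
  rw [inW_mk, S.mem_shift (-1)] at hw'
  have hlab : Function.update w (k + l + 1) β (k + 1 + (l : ℕ)) = β := by
    rw [show k + 1 + ((l : ℕ) : ℤ) = k + l + 1 by ring]; simp
  refine ⟨x, rfl, _, ?_, hw', ?_⟩
  · exact hlab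
  · apply inW_ext S k
    intro w1
    refine (hc w1 _).trans (Iff.trans ?_ ((hc w1 s).trans (h _ (by simp))).symm)
    exact ep_prop S (l := l) ⟨(_, β, _), x, rfl, _, hlab, hw', rfl⟩ k _ (by simp)

section configs
variable [Fintype A] {S : Subshift A}

def cv (x : Config (canonicalLGBS S)) (k : ℤ) (n : ℕ) : Vcan S n := x.v k n

theorem lm_eq (x : Config (canonicalLGBS S)) (k : ℤ) (n : ℕ) :
    (canonicalLGBS S).lm n (x.em k n) = configSeq x k := by
  obtain ⟨xs, h1, h2⟩ := x.label
  unfold configSeq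
  rw [h1, h1]

theorem lp_eq (x : Config (canonicalLGBS S)) (k : ℤ) (n : ℕ) :
    (canonicalLGBS S).lp n (x.ep k n) = configSeq x (k + n + 1) := by
  obtain ⟨xs, h1, h2⟩ := x.label
  unfold configSeq
  rw [h1, h2]

theorem cv_em (x : Config (canonicalLGBS S)) (k : ℤ) (n : ℕ) (w : ℤ → A)
    (hw : w k = configSeq x k) :
    InW S (cv x k n) k w ↔ InW S (cv x (k - 1) (n + 1)) (k - 1) w := by
  have h := em_prop S (l := n) (x.em k n) k w (hw.trans (lm_eq x k n).symm)
  have hs : (show EmCan S n from x.em k n).val.1 = cv x (k - 1) (n + 1) := x.em_s k n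
  have ht : (show EmCan S n from x.em k n).val.2.2 = cv x k n := x.em_t k n
  rw [← hs, ← ht]
  exact h

theorem cv_ep (x : Config (canonicalLGBS S)) (k : ℤ) (n : ℕ) (w : ℤ → A)
    (hw : w (k + n + 1) = configSeq x (k + n + 1)) :
    InW S (cv x k n) k w ↔ InW S (cv x k (n + 1)) k w := by
  have h := ep_prop S (l := n) (x.ep k n) k w (hw.trans (lp_eq x k n).symm)
  have hs : (show EpCan S n from x.ep k n).val.1 = cv x k n := x.ep_s k n
  have ht : (show EpCan S n from x.ep k n).val.2.2 = cv x k (n + 1) := x.ep_t k n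
  rw [← hs, ← ht]
  exact h

theorem em_ext {n : ℕ} (e f : (canonicalLGBS S).Em n)
    (h1 : (canonicalLGBS S).sm n e = (canonicalLGBS S).sm n f)
    (h2 : (canonicalLGBS S).lm n e = (canonicalLGBS S).lm n f)
    (h3 : (canonicalLGBS S).tm n e = (canonicalLGBS S).tm n f) : e = f :=
  Subtype.ext (Prod.ext h1 (Prod.ext h2 h3))

theorem ep_ext {n : ℕ} (e f : (canonicalLGBS S).Ep n)
    (h1 : (canonicalLGBS S).sp n e = (canonicalLGBS S).sp n f)
    (h2 : (canonicalLGBS S).lp n e = (canonicalLGBS S).lp n f)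
    (h3 : (canonicalLGBS S).tp n e = (canonicalLGBS S).tp n f) : e = f :=
  Subtype.ext (Prod.ext h1 (Prod.ext h2 h3))

theorem em_eq (x z : Config (canonicalLGBS S)) (k : ℤ) (n : ℕ)
    (h1 : cv x (k - 1) (n + 1) = cv z (k - 1) (n + 1)) (h2 : cv x k n = cv z k n)
    (h3 : configSeq x k = configSeq z k) : x.em k n = z.em k n := by
  apply em_ext
  · exact (x.em_s k n).trans (h1.trans (z.em_s k n).symm)
  · exact (lm_eq x k n).trans (h3.trans (lm_eq z k n).symm)
  · exact (x.em_t k n).trans (h2.trans (z.em_t k n).symm)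

theorem ep_eq (x z : Config (canonicalLGBS S)) (k : ℤ) (n : ℕ)
    (h1 : cv x k (n + 1) = cv z k (n + 1)) (h2 : cv x k n = cv z k n)
    (h3 : configSeq x (k + n + 1) = configSeq z (k + n + 1)) : x.ep k n = z.ep k n := by
  apply ep_ext
  · exact (x.ep_s k n).trans (h2.trans (z.ep_s k n).symm)
  · exact (lp_eq x k n).trans (h3.trans (lp_eq z k n).symm)
  · exact (x.ep_t k n).trans (h1.trans (z.ep_t k n).symm)

theorem config_ext (x z : Config (canonicalLGBS S)) (h : ∀ k n, cv x k n = cv z k n)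
    (h' : ∀ k, configSeq x k = configSeq z k) : x = z := by
  have hv : x.v = z.v := by funext k n; exact h k n
  have hm : x.em = z.em := by funext k n; exact em_eq x z k n (h _ _) (h _ _) (h' _)
  have hp : x.ep = z.ep := by funext k n; exact ep_eq x z k n (h _ _) (h _ _) (h' _)
  cases x; cases z
  dsimp only at hv hm hp
  subst hv hm hp
  rfl

def mkConfig (S : Subshift A) (xs : ℤ → A) (v : ℤ → ∀ n : ℕ, Vcan S n)
    (hm : ∀ (k : ℤ) (n : ℕ) (w : ℤ → A), w k = xs k → (InW S (v k n) k w ↔ InW S (v (k - 1) (n + 1)) (k - 1) w))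
    (hp : ∀ (k : ℤ) (n : ℕ) (w : ℤ → A), w (k + n + 1) = xs (k + n + 1) →
      (InW S (v k n) k w ↔ InW S (v k (n + 1)) k w)) : Config (canonicalLGBS S) where
  v := v
  em := fun k n => (⟨(v (k - 1) (n + 1), xs k, v k n), em_exists S _ _ _ k (hm k n)⟩ : EmCan S n)
  ep := fun k n =>
    (⟨(v k n, xs (k + n + 1), v k (n + 1)), ep_exists S _ _ _ k (hp k n)⟩ : EpCan S n)
  em_s := fun _ _ => rfl
  em_t := fun _ _ => rfl
  ep_s := fun _ _ => rfl
  ep_t := fun _ _ => rfl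
  label := ⟨xs, fun _ _ => rfl, fun _ _ => rfl⟩

theorem inW_self (x : Config (canonicalLGBS S)) (k : ℤ) (n : ℕ) :
    InW S (cv x k n) k (configSeq x) := by
  induction n with
  | zero => exact inW_zero S _ _ _
  | succ n ih => exact (cv_ep x k n _ rfl).1 ih

/-- `y` represents the configuration `x` at the window `(k, k+n+1)`. -/
structure CRep (x : Config (canonicalLGBS S)) (k : ℤ) (n : ℕ) (y : {a // a ∈ S.carrier}) :
    Prop where
  agree : ∀ i, k < i → i < k + n + 1 → y.val i = configSeq x i
  cls_eq : cls S y k n = cv x k n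

/-- gluing a word admissible at the window of a representative -/
theorem CRep.glue_mem {x : Config (canonicalLGBS S)} {k : ℤ} {n : ℕ} {y : {a // a ∈ S.carrier}}
    (h : cls S y k n = cv x k n) (w : ℤ → A) (hw : InW S (cv x k n) k w) :
    glue k (k + n + 1) w y.val ∈ S.carrier := by
  rwa [← h, inW_cls] at hw

theorem exists_rep (x : Config (canonicalLGBS S)) (k : ℤ) (n : ℕ) : ∃ y, CRep x k n y := by
  obtain ⟨y, hy⟩ := cls_surj S k (cv x k n)
  refine ⟨⟨_, CRep.glue_mem hy _ (inW_self x k n)⟩, ?_, ?_⟩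
  · intro i h1 h2
    simp [glue, h1, h2]
  · rw [← hy]
    apply cls_congr
    intro i hi
    simp only [glue]
    rw [if_neg (by omega)]

theorem CRep.right {x : Config (canonicalLGBS S)} {k : ℤ} {n : ℕ} {y : {a // a ∈ S.carrier}}
    (h : CRep x k (n + 1) y) : CRep x k n y := by
  refine ⟨fun i h1 h2 => h.agree i h1 (by push_cast; omega), ?_⟩
  apply inW_ext S k
  intro w
  have hc : ∀ v, InW S v k w ↔
      InW S (n := n) v k (Function.update w (k + n + 1) (configSeq x (k + n + 1))) :=
    fun v => inW_congr S v k (fun i h1 h2 => by rw [Function.update_of_ne (by omega)])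
  rw [hc, hc, cv_ep x k n _ (by simp), ← h.cls_eq, inW_cls, inW_cls]
  generalize hW : Function.update w (k + n + 1) (configSeq x (k + n + 1)) = W
  have h0 : W (k + n + 1) = configSeq x (k + n + 1) := by rw [← hW]; simp
  have : glue k (k + n + 1) W y.val = glue k (k + (n + 1 : ℕ) + 1) W y.val := by
    funext i
    by_cases hi : i = k + n + 1
    · subst hi
      have := h.agree (k + n + 1) (by omega) (by push_cast; omega)
      simp only [glue]
      rw [if_neg (by omega), if_pos (by push_cast; omega), this, h0]
    · simp only [glue]
      push_cast
      by_cases h' : k < i ∧ i < k + n + 1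
      · rw [if_pos h', if_pos (by omega)]
      · rw [if_neg h', if_neg (by omega)]
  rw [this]

theorem CRep.left {x : Config (canonicalLGBS S)} {k : ℤ} {n : ℕ} {y : {a // a ∈ S.carrier}}
    (h : CRep x (k - 1) (n + 1) y) : CRep x k n y := by
  refine ⟨fun i h1 h2 => h.agree i (by omega) (by push_cast; omega), ?_⟩
  apply inW_ext S k
  intro w
  have hc : ∀ v, InW S v k w ↔
      InW S (n := n) v k (Function.update w k (configSeq x k)) :=
    fun v => inW_congr S v k (fun i h1 h2 => by rw [Function.update_of_ne (by omega)])
  rw [hc, hc, cv_em x k n _ (by simp), ← h.cls_eq, inW_cls, inW_cls]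
  generalize hW : Function.update w k (configSeq x k) = W
  have h0 : W k = configSeq x k := by rw [← hW]; simp
  have : glue k (k + n + 1) W y.val = glue (k - 1) (k - 1 + (n + 1 : ℕ) + 1) W y.val := by
    funext i
    by_cases hi : i = k
    · subst hi
      have := h.agree i (by omega) (by push_cast; omega)
      simp only [glue]
      rw [if_neg (by omega), if_pos (by push_cast; omega), this, h0]
    · simp only [glue]
      push_cast
      by_cases h' : k < i ∧ i < k + n + 1
      · rw [if_pos h', if_pos (by omega)]
      · rw [if_neg h', if_neg (by omega)]
  rw [this]

theorem CRep.mono {x : Config (canonicalLGBS S)} {k k' : ℤ} {n n' : ℕ} {y : {a // a ∈ S.carrier}}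
    (h : CRep x k' n' y) (h1 : k' ≤ k) (h2 : k + n ≤ k' + n') : CRep x k n y := by
  have hl : ∀ (a : ℕ) (k : ℤ) (n : ℕ), CRep x (k - a) (n + a) y → CRep x k n y := by
    intro a
    induction a with
    | zero => intro k n h; simpa using h
    | succ a ih =>
      intro k n h
      apply CRep.left
      apply ih
      have e1 : k - ((a + 1 : ℕ) : ℤ) = k - 1 - a := by push_cast; ring
      have e2 : n + (a + 1) = n + 1 + a := by ring
      rwa [e1, e2] at h
  have hr : ∀ (a : ℕ) (k : ℤ) (n : ℕ), CRep x k (n + a) y → CRep x k n y := by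
    intro a
    induction a with
    | zero => intro k n h; simpa using h
    | succ a ih =>
      intro k n h
      exact ih _ _ (CRep.right h)
  apply hl (k - k').toNat
  apply hr (k' + n' - k - n).toNat
  have e1 : k - ((k - k').toNat : ℤ) = k' := by omega
  have e2 : n + (k - k').toNat + (k' + n' - k - n).toNat = n' := by omega
  rwa [e1, e2]

theorem configSeq_mem (x : Config (canonicalLGBS S)) : configSeq x ∈ S.carrier := by
  choose y hy using fun N : ℕ => exists_rep x (-(N : ℤ)) (2 * N)
  let _ : TopologicalSpace A := ⊥
  have hcl : IsClosed S.carrier := S.closed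
  refine hcl.mem_of_tendsto (f := fun N => (y N).val) (b := Filter.atTop) ?_
    (Filter.Eventually.of_forall fun N => (y N).prop)
  refine tendsto_pi_nhds.2 fun i => ?_
  refine tendsto_const_nhds.congr' ?_
  filter_upwards [Filter.eventually_ge_atTop (i.natAbs + 1)] with N hN
  exact ((hy N).agree i (by omega) (by push_cast; omega)).symm

theorem pword_iff (x z : Config (canonicalLGBS S)) (p : ℤ) (n : ℕ) :
    Pword x p n = Pword z p n ↔ ∀ i, p < i → i < p + n + 1 → configSeq x i = configSeq z i := by
  induction n with
  | zero => simp [Pword]; intro i h1 h2; omega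
  | succ n ih =>
    simp only [Pword, lp_eq]
    constructor
    · intro h
      obtain ⟨h1, h2⟩ := List.append_inj' h rfl
      intro i hi hi'
      by_cases hin : i = p + n + 1
      · subst hin; simpa using h2
      · exact ih.1 h1 i hi (by push_cast at hi'; omega)
    · intro h
      rw [ih.2 (fun i h1 h2 => h i h1 (by push_cast; omega)),
        h (p + n + 1) (by omega) (by push_cast; omega)]

theorem pword_mem (x : Config (canonicalLGBS S)) (p : ℤ) (n : ℕ) :
    Pword x p n ∈ (canonicalLGBS S).Pset n (x.v p n) := by
  induction n with
  | zero => exact rfl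
  | succ n ih =>
    exact ⟨x.ep p n, x.ep_t p n, Pword x p n, by rw [x.ep_s]; exact ih, rfl⟩

theorem rectEq_iff (x z : Config (canonicalLGBS S)) (p q : ℤ) :
    RectEq x z p q ↔ (∀ (k : ℤ) (n : ℕ), k ≤ p → q ≤ k + n + 1 → cv x k n = cv z k n) ∧
      (∀ i, i ≤ p → configSeq x i = configSeq z i) ∧
      (∀ i, q ≤ i → configSeq x i = configSeq z i) := by
  constructor
  · intro h
    refine ⟨fun k n h1 h2 => (h k n h1 h2).1, fun i hi => ?_, fun i hi => ?_⟩
    · have := (h i (q - i).toNat hi (by omega)).2.1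
      rw [← lm_eq x i (q - i).toNat, this, lm_eq]
    · have h1 := (h (min p (i - 1)) (i - min p (i - 1) - 1).toNat (by omega) (by omega)).2.2
      have h2 := lp_eq x (min p (i - 1)) (i - min p (i - 1) - 1).toNat
      rw [h1, lp_eq] at h2
      have e : min p (i - 1) + ((i - min p (i - 1) - 1).toNat : ℤ) + 1 = i := by omega
      rw [e] at h2
      exact h2.symm
  · rintro ⟨h1, h2, h3⟩ k n hk hn
    refine ⟨h1 k n hk hn, em_eq _ _ _ _ (h1 _ _ (by omega) (by push_cast; omega)) (h1 _ _ hk hn)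
      (h2 _ hk), ep_eq _ _ _ _ (h1 _ _ hk (by push_cast; omega)) (h1 _ _ hk hn) (h3 _ hn)⟩

end configs

structure LConj {A₁ A₂ : Type} (S₁ : Subshift A₁) (S₂ : Subshift A₂) where
  F : {a // a ∈ S₁.carrier} → {b // b ∈ S₂.carrier}
  G : {b // b ∈ S₂.carrier} → {a // a ∈ S₁.carrier}
  GF : ∀ y, G (F y) = y
  FG : ∀ y, F (G y) = y
  r : ℕ
  locF : ∀ (y z : {a // a ∈ S₁.carrier}) (j : ℤ),
    (∀ i, j - r ≤ i → i ≤ j + r → y.val i = z.val i) → (F y).val j = (F z).val j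
  locG : ∀ (y z : {a // a ∈ S₂.carrier}) (j : ℤ),
    (∀ i, j - r ≤ i → i ≤ j + r → y.val i = z.val i) → (G y).val j = (G z).val j

section lconj
variable {A₁ A₂ : Type} {S₁ : Subshift A₁} {S₂ : Subshift A₂}

def LConj.symm (c : LConj S₁ S₂) : LConj S₂ S₁ where
  F := c.G
  G := c.F
  GF := c.FG
  FG := c.GF
  r := c.r
  locF := c.locG
  locG := c.locF

theorem LConj.key1 (c : LConj S₁ S₂) (y z : {a // a ∈ S₁.carrier}) (k q P Q : ℤ)
    (hP : P = k - 3 * c.r) (hQ : Q = q + 3 * c.r)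
    (hag : ∀ i, P < i → i < Q → y.val i = z.val i)
    (hg : ∀ w, glue P Q w y.val ∈ S₁.carrier → glue P Q w z.val ∈ S₁.carrier)
    (w : ℤ → A₂) (hw : glue k q w (c.F y).val ∈ S₂.carrier) :
    glue k q w (c.F z).val ∈ S₂.carrier := by
  obtain ⟨u, hu⟩ : ∃ u, u = c.G ⟨_, hw⟩ := ⟨_, rfl⟩
  have hFu : (c.F u).val = glue k q w (c.F y).val := by rw [hu, c.FG]
  have hout : ∀ i, i ≤ k - c.r ∨ q + c.r ≤ i → u.val i = y.val i := by
    intro i hi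
    rw [hu]
    conv_rhs => rw [← c.GF y]
    apply c.locG
    intro j h1 h2
    simp only [glue]
    rw [if_neg (by omega)]
  have h1 : glue P Q u.val y.val = u.val := by
    funext i
    simp only [glue]
    split_ifs with h
    · rfl
    · exact (hout i (by omega)).symm
  have h2 := hg u.val (by rw [h1]; exact u.prop)
  have h3 : (c.F ⟨_, h2⟩).val = glue k q w (c.F z).val := by
    funext i
    by_cases hi : k - 2 * c.r < i ∧ i < q + 2 * c.r
    · have e1 : (c.F ⟨_, h2⟩).val i = (c.F u).val i := by
        apply c.locF
        intro j h1 h2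
        simp only [glue]
        rw [if_pos (by omega)]
      have e2 : (c.F y).val i = (c.F z).val i := by
        apply c.locF
        intro j h1 h2
        exact hag j (by omega) (by omega)
      rw [e1, hFu]
      simp only [glue, e2]
    · have e1 : (c.F ⟨_, h2⟩).val i = (c.F z).val i := by
        apply c.locF
        intro j h1 h2
        simp only [glue]
        split_ifs with h
        · rw [hout j (by omega)]
          exact hag j h.1 h.2
        · rfl
      rw [e1]
      simp only [glue]
      rw [if_neg (by omega)]
  rw [← h3]
  exact (c.F _).prop

variable [Fintype A₁] [Fintype A₂]

theorem LConj.key2 (c : LConj S₁ S₂) {x : Config (canonicalLGBS S₁)} {k K : ℤ} {n M : ℕ}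
    {y z : {a // a ∈ S₁.carrier}} (hK : K = k - 3 * c.r) (hM : M = n + 6 * c.r)
    (hy : CRep x K M y) (hz : CRep x K M z) : cls S₂ (c.F y) k n = cls S₂ (c.F z) k n := by
  have main : ∀ y z : {a // a ∈ S₁.carrier}, CRep x K M y → CRep x K M z → ∀ w,
      glue k (k + n + 1) w (c.F y).val ∈ S₂.carrier →
      glue k (k + n + 1) w (c.F z).val ∈ S₂.carrier := by
    intro y z hy hz w
    apply c.key1 y z k (k + n + 1) K (K + M + 1) hK (by push_cast [hM]; omega)
    · intro i h1 h2
      rw [hy.agree i h1 h2, hz.agree i h1 h2]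
    · intro w' hw'
      rw [← inW_cls, hz.cls_eq, ← hy.cls_eq, inW_cls]
      exact hw'
  apply inW_ext S₂ k
  intro w
  rw [inW_cls, inW_cls]
  exact ⟨main y z hy hz w, main z y hz hy w⟩

noncomputable def cpt (x : Config (canonicalLGBS S₁)) : {a // a ∈ S₁.carrier} := ⟨configSeq x, configSeq_mem x⟩

noncomputable def crep (x : Config (canonicalLGBS S₁)) (k : ℤ) (n : ℕ) : {a // a ∈ S₁.carrier} :=
  (exists_rep x k n).choose

theorem crep_spec (x : Config (canonicalLGBS S₁)) (k : ℤ) (n : ℕ) : CRep x k n (crep x k n) :=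
  (exists_rep x k n).choose_spec

theorem LConj.agree (c : LConj S₁ S₂) {x : Config (canonicalLGBS S₁)} {k K : ℤ} {n M : ℕ}
    {y : {a // a ∈ S₁.carrier}} (hK : K = k - 3 * c.r) (hM : M = n + 6 * c.r)
    (hy : CRep x K M y) (i : ℤ) (h1 : k < i) (h2 : i < k + n + 1) :
    (c.F y).val i = (c.F (cpt x)).val i := by
  apply c.locF
  intro j h3 h4
  exact hy.agree j (by omega) (by push_cast [hM]; omega)

/-- The map on configuration spaces. -/
noncomputable def LConj.hmap (c : LConj S₁ S₂) (x : Config (canonicalLGBS S₁)) :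
    Config (canonicalLGBS S₂) :=
  mkConfig S₂ (c.F (cpt x)).val
    (fun k n => cls S₂ (c.F (crep x (k - 3 * c.r) (n + 6 * c.r))) k n)
    (by
      intro k n w hw
      have hz := crep_spec x (k - 1 - 3 * c.r) (n + 1 + 6 * c.r)
      generalize crep x (k - 1 - 3 * c.r) (n + 1 + 6 * c.r) = z at hz
      rw [c.key2 rfl rfl (crep_spec x (k - 3 * c.r) (n + 6 * c.r))
        (hz.mono (by omega) (by push_cast; omega)), inW_cls, inW_cls]
      have : glue k (k + n + 1) w (c.F z).val =
          glue (k - 1) (k - 1 + (n + 1 : ℕ) + 1) w (c.F z).val := by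
        funext i
        simp only [glue]
        push_cast
        by_cases hi : i = k
        · subst hi
          rw [if_neg (by omega), if_pos (by omega), hw]
          exact c.agree rfl rfl hz i (by omega) (by push_cast; omega)
        · by_cases h' : k < i ∧ i < k + n + 1
          · rw [if_pos h', if_pos (by omega)]
          · rw [if_neg h', if_neg (by omega)]
      rw [this])
    (by
      intro k n w hw
      have hz := crep_spec x (k - 3 * c.r) (n + 1 + 6 * c.r)
      generalize crep x (k - 3 * c.r) (n + 1 + 6 * c.r) = z at hz
      rw [c.key2 rfl rfl (crep_spec x (k - 3 * c.r) (n + 6 * c.r))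
        (hz.mono (by omega) (by push_cast; omega)), inW_cls, inW_cls]
      have : glue k (k + n + 1) w (c.F z).val =
          glue k (k + (n + 1 : ℕ) + 1) w (c.F z).val := by
        funext i
        simp only [glue]
        push_cast
        by_cases hi : i = k + n + 1
        · subst hi
          rw [if_neg (by omega), if_pos (by omega), hw]
          exact c.agree rfl rfl hz _ (by omega) (by push_cast; omega)
        · by_cases h' : k < i ∧ i < k + n + 1
          · rw [if_pos h', if_pos (by omega)]
          · rw [if_neg h', if_neg (by omega)]
      rw [this])

theorem LConj.seq_hmap (c : LConj S₁ S₂) (x : Config (canonicalLGBS S₁)) :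
    configSeq (c.hmap x) = (c.F (cpt x)).val := rfl

theorem LConj.cpt_hmap (c : LConj S₁ S₂) (x : Config (canonicalLGBS S₁)) :
    cpt (c.hmap x) = c.F (cpt x) := rfl

theorem LConj.rep_hmap (c : LConj S₁ S₂) {x : Config (canonicalLGBS S₁)} {k K : ℤ} {n M : ℕ}
    {y : {a // a ∈ S₁.carrier}} (hy : CRep x K M y) (hK : K ≤ k - 3 * c.r)
    (hM : k + n + 3 * c.r ≤ K + M) : CRep (c.hmap x) k n (c.F y) := by
  have hy' : CRep x (k - 3 * c.r) (n + 6 * c.r) y := hy.mono hK (by push_cast; omega)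
  refine ⟨fun i h1 h2 => c.agree rfl rfl hy' i h1 h2, ?_⟩
  exact c.key2 rfl rfl hy' (crep_spec x (k - 3 * c.r) (n + 6 * c.r))

theorem LConj.symm_hmap (c : LConj S₁ S₂) (x : Config (canonicalLGBS S₁)) :
    c.symm.hmap (c.hmap x) = x := by
  apply config_ext
  · intro k n
    obtain ⟨y, hy⟩ := exists_rep x (k - 6 * c.r) (n + 12 * c.r)
    have h1 : CRep (c.hmap x) (k - 3 * c.r) (n + 6 * c.r) (c.F y) :=
      c.rep_hmap hy (by omega) (by push_cast; omega)
    have h2 : CRep (c.symm.hmap (c.hmap x)) k n (c.symm.F (c.F y)) :=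
      c.symm.rep_hmap h1 (show _ ≤ k - 3 * (c.r : ℤ) by omega)
        (show k + n + 3 * (c.r : ℤ) ≤ _ by push_cast; omega)
    have h3 : c.symm.F (c.F y) = y := c.GF y
    rw [h3] at h2
    have h4 : CRep x k n y := hy.mono (by omega) (by push_cast; omega)
    rw [← h2.cls_eq, h4.cls_eq]
  · intro k
    rw [c.symm.seq_hmap, c.cpt_hmap]
    change (c.G (c.F (cpt x))).val k = _
    rw [c.GF]; rfl

theorem LConj.continuous_hmap (c : LConj S₁ S₂) : Continuous c.hmap := by
  refine continuous_generateFrom_iff.2 ?_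
  rintro U ⟨p, n, v, μ, hμ, rfl⟩
  rw [isOpen_iff_forall_mem_open]
  rintro x ⟨hx1, hx2⟩
  refine ⟨Cyl (p - 3 * c.r) (n + 6 * c.r) (x.v _ _) (Pword x (p - 3 * c.r) (n + 6 * c.r)), ?_,
    TopologicalSpace.isOpen_generateFrom_of_mem ⟨_, _, _, _, pword_mem x _ _, rfl⟩, ⟨rfl, rfl⟩⟩
  rintro x' ⟨h1, h2⟩
  rw [pword_iff] at h2
  obtain ⟨y, hy⟩ := exists_rep x (p - 3 * c.r) (n + 6 * c.r)
  have hy' : CRep x' (p - 3 * c.r) (n + 6 * c.r) y :=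
    ⟨fun i hi hi' => (hy.agree i hi hi').trans (h2 i hi hi').symm, hy.cls_eq.trans h1.symm⟩
  have e : CRep (c.hmap x) p n (c.F y) := c.rep_hmap hy (by omega) (by push_cast; omega)
  have e' : CRep (c.hmap x') p n (c.F y) := c.rep_hmap hy' (by omega) (by push_cast; omega)
  refine ⟨?_, ?_⟩
  · rw [← hx1]
    exact e'.cls_eq.symm.trans e.cls_eq
  · rw [← hx2, pword_iff]
    intro i hi hi'
    rw [← e'.agree i hi hi', e.agree i hi hi']

theorem LConj.rect_hmap (c : LConj S₁ S₂) {x z : Config (canonicalLGBS S₁)} {p q : ℤ}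
    (h : RectEq x z p q) : RectEq (c.hmap x) (c.hmap z) (p - 3 * c.r) (q + 3 * c.r) := by
  rw [rectEq_iff] at h ⊢
  obtain ⟨hv, hl, hr⟩ := h
  refine ⟨fun k n hk hn => ?_, fun i hi => ?_, fun i hi => ?_⟩
  · obtain ⟨y, hy⟩ := exists_rep x (k - 3 * c.r) (n + 6 * c.r)
    have hvv := hv (k - 3 * c.r) (n + 6 * c.r) (by omega) (by push_cast; omega)
    have hm := CRep.glue_mem hy.cls_eq (configSeq z) (by rw [hvv]; exact inW_self z _ _)
    obtain ⟨z', hz'⟩ : ∃ z' : {a // a ∈ S₁.carrier}, z' = ⟨_, hm⟩ := ⟨_, rfl⟩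
    have hzr : CRep z (k - 3 * c.r) (n + 6 * c.r) z' := by
      refine ⟨fun i h1 h2 => ?_, ?_⟩
      · rw [hz']
        simp only [glue]
        rw [if_pos ⟨h1, h2⟩]
      · rw [← hvv, ← hy.cls_eq, hz']
        apply cls_congr
        intro i hi
        simp only [glue]
        rw [if_neg (by omega)]
    have hout : ∀ i, i ≤ p ∨ q ≤ i → y.val i = z'.val i := by
      intro i hi
      rw [hz']
      simp only [glue]
      split_ifs with h
      · rw [hy.agree i h.1 h.2]
        rcases hi with hi | hi
        · exact hl i hi
        · exact hr i hi
      · rfl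
    have e : CRep (c.hmap x) k n (c.F y) := c.rep_hmap hy (by omega) (by push_cast; omega)
    have e' : CRep (c.hmap z) k n (c.F z') := c.rep_hmap hzr (by omega) (by push_cast; omega)
    rw [← e.cls_eq, ← e'.cls_eq]
    apply cls_congr
    intro i hi
    apply c.locF
    intro j h1 h2
    exact hout j (by omega)
  · rw [c.seq_hmap, c.seq_hmap]
    apply c.locF
    intro j h1 h2
    exact hl j (by omega)
  · rw [c.seq_hmap, c.seq_hmap]
    apply c.locF
    intro j h1 h2
    exact hr j (by omega)

noncomputable def LConj.hR (c : LConj S₁ S₂) (y : ↥(Rset (canonicalLGBS S₁))) : ↥(Rset (canonicalLGBS S₂)) :=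
  ⟨(c.hmap y.val.1, c.hmap y.val.2), by
    obtain ⟨p, q, hpq, h⟩ := y.prop
    exact ⟨_, _, by omega, c.rect_hmap h⟩⟩

theorem LConj.continuous_hR (c : LConj S₁ S₂) :
    @Continuous _ _ (indTop (canonicalLGBS S₁)) (indTop (canonicalLGBS S₂)) c.hR := by
  unfold indTop
  refine continuous_iSup_dom.2 fun p => continuous_iSup_dom.2 fun q =>
    continuous_iSup_dom.2 fun hpq => continuous_coinduced_dom.2 ?_
  refine continuous_iSup_rng (i := p - 3 * c.r) (continuous_iSup_rng (i := q + 3 * c.r)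
    (continuous_iSup_rng (i := by omega) ?_))
  let g : ↥(RpqSet (canonicalLGBS S₁) p q) →
      ↥(RpqSet (canonicalLGBS S₂) (p - 3 * c.r) (q + 3 * c.r)) :=
    fun y => ⟨(c.hmap y.val.1, c.hmap y.val.2), c.rect_hmap y.prop⟩
  have hg : Continuous g := by
    refine Continuous.subtype_mk ?_ _
    exact (c.continuous_hmap.comp (continuous_fst.comp continuous_subtype_val)).prodMk
      (c.continuous_hmap.comp (continuous_snd.comp continuous_subtype_val))
  have hi := continuous_coinduced_rng (t := inferInstance)
    (f := inclPQ (canonicalLGBS S₂) (p - 3 * c.r) (q + 3 * c.r) (by omega))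
  exact @Continuous.comp _ _ _ _ _ (_) g
    (inclPQ (canonicalLGBS S₂) (p - 3 * c.r) (q + 3 * c.r) (by omega)) hi hg

theorem LConj.symm_hR (c : LConj S₁ S₂) (y : ↥(Rset (canonicalLGBS S₁))) :
    c.symm.hR (c.hR y) = y := by
  apply Subtype.ext
  exact Prod.ext (c.symm_hmap _) (c.symm_hmap _)

theorem LConj.hmap_shift (c : LConj S₁ S₂)
    (heq : ∀ a, c.F (S₁.shiftMap a) = S₂.shiftMap (c.F a)) (x : Config (canonicalLGBS S₁)) :
    c.hmap (shiftBy (canonicalLGBS S₁) 1 x) = shiftBy (canonicalLGBS S₂) 1 (c.hmap x) := by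
  have hcls : ∀ {B : Type} (S : Subshift B) (y : {a // a ∈ S.carrier}) (k : ℤ) (n : ℕ),
      cls S (S.shiftMap y) k n = cls S y (k + 1) n := by
    intro B S y k n
    unfold cls Subshift.shiftMap
    congr 1
    apply Subtype.ext
    funext i
    dsimp only
    ring_nf
  apply config_ext
  · intro k n
    obtain ⟨y, hy⟩ := exists_rep x (k + 1 - 3 * c.r) (n + 6 * c.r)
    have hy' : CRep (shiftBy (canonicalLGBS S₁) 1 x) (k - 3 * c.r) (n + 6 * c.r)
        (S₁.shiftMap y) := by
      refine ⟨fun i h1 h2 => hy.agree (i + 1) (by omega) (by omega), ?_⟩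
      rw [hcls]
      have := hy.cls_eq
      rw [show k + 1 - 3 * (c.r : ℤ) = k - 3 * c.r + 1 by ring] at this
      exact this
    have e : CRep (c.hmap x) (k + 1) n (c.F y) := c.rep_hmap hy (by omega) (by push_cast; omega)
    have e' : CRep (c.hmap (shiftBy (canonicalLGBS S₁) 1 x)) k n (c.F (S₁.shiftMap y)) :=
      c.rep_hmap hy' (by omega) (by push_cast; omega)
    rw [← e'.cls_eq, heq, hcls]
    exact e.cls_eq
  · intro k
    have : cpt (shiftBy (canonicalLGBS S₁) 1 x) = S₁.shiftMap (cpt x) := rfl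
    rw [c.seq_hmap, this, heq]
    rfl

end lconj

/-- A continuous equivariant map of subshifts is a sliding block code. -/
theorem exists_radius {A₁ A₂ : Type} [Fintype A₁] (S₁ : Subshift A₁) (S₂ : Subshift A₂)
    (F : {a // a ∈ S₁.carrier} → {b // b ∈ S₂.carrier})
    (hF : @Continuous _ _ (subTop S₁) (subTop S₂) F)
    (heq : ∀ a, F (S₁.shiftMap a) = S₂.shiftMap (F a)) :
    ∃ r : ℕ, ∀ r' : ℕ, r ≤ r' → ∀ (y z : {a // a ∈ S₁.carrier}) (j : ℤ),
      (∀ i, j - r' ≤ i → i ≤ j + r' → y.val i = z.val i) → (F y).val j = (F z).val j := by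
  let _ : TopologicalSpace A₁ := ⊥
  let _ : TopologicalSpace A₂ := ⊥
  have : DiscreteTopology A₁ := ⟨rfl⟩
  have : DiscreteTopology A₂ := ⟨rfl⟩
  have hF' : Continuous F := hF
  have hcl : IsClosed S₁.carrier := S₁.closed
  have : CompactSpace {a // a ∈ S₁.carrier} := isCompact_iff_compactSpace.1 hcl.isCompact
  have hF0 : Continuous fun y => (F y).val 0 :=
    (continuous_apply 0).comp (continuous_subtype_val.comp hF')
  let K : ℕ → Set ({a // a ∈ S₁.carrier} × {a // a ∈ S₁.carrier}) := fun n =>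
    {yz | (∀ i : ℤ, -n ≤ i → i ≤ n → yz.1.val i = yz.2.val i) ∧ (F yz.1).val 0 ≠ (F yz.2).val 0}
  have hKcl : ∀ n, IsClosed (K n) := by
    intro n
    have hA : IsClosed {yz : {a // a ∈ S₁.carrier} × {a // a ∈ S₁.carrier} |
        ∀ i : ℤ, -n ≤ i → i ≤ n → yz.1.val i = yz.2.val i} := by
      have e : {yz : {a // a ∈ S₁.carrier} × {a // a ∈ S₁.carrier} |
          ∀ i : ℤ, -n ≤ i → i ≤ n → yz.1.val i = yz.2.val i} =
          ⋂ i : ℤ, ⋂ (_ : -n ≤ i), ⋂ (_ : i ≤ n),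
            {yz : {a // a ∈ S₁.carrier} × {a // a ∈ S₁.carrier} |
              yz.1.val i = yz.2.val i} := by
        ext; simp
      rw [e]
      refine isClosed_iInter fun i => isClosed_iInter fun _ => isClosed_iInter fun _ => ?_
      exact isClosed_eq
        ((continuous_apply i).comp (continuous_subtype_val.comp continuous_fst))
        ((continuous_apply i).comp (continuous_subtype_val.comp continuous_snd))
    have hB : IsClosed {yz : {a // a ∈ S₁.carrier} × {a // a ∈ S₁.carrier} |
        (F yz.1).val 0 ≠ (F yz.2).val 0} := by
      have h1 : Continuous fun yz : {a // a ∈ S₁.carrier} × {a // a ∈ S₁.carrier} =>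
          ((F yz.1).val 0, (F yz.2).val 0) :=
        (hF0.comp continuous_fst).prodMk (hF0.comp continuous_snd)
      exact (isClosed_discrete {p : A₂ × A₂ | p.1 ≠ p.2}).preimage h1
    exact hA.inter hB
  have hex : ∃ n, K n = ∅ := by
    by_contra hne
    push Not at hne
    obtain ⟨yz, hyz⟩ := IsCompact.nonempty_iInter_of_sequence_nonempty_isCompact_isClosed K
      (fun n yz h => ⟨fun i h1 h2 => h.1 i (by push_cast; omega) (by push_cast; omega), h.2⟩)
      hne ((hKcl 0).isCompact) hKcl
    rw [Set.mem_iInter] at hyz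
    apply (hyz 0).2
    have : yz.1 = yz.2 := by
      apply Subtype.ext
      funext i
      exact (hyz i.natAbs).1 i (by omega) (by omega)
    rw [this]
  obtain ⟨r, hr⟩ := hex
  have h0 : ∀ y z : {a // a ∈ S₁.carrier},
      (∀ i : ℤ, -r ≤ i → i ≤ r → y.val i = z.val i) → (F y).val 0 = (F z).val 0 := by
    intro y z h
    by_contra hne
    have : (y, z) ∈ K r := ⟨h, hne⟩
    rw [hr] at this
    exact this
  have sh : ∀ (j : ℤ) (y : {a // a ∈ S₁.carrier}),
      (F y).val j = (F ⟨fun i => y.val (i + j), (S₁.mem_shift _ _).1 y.prop⟩).val 0 := by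
    intro j
    induction j using Int.induction_on with
    | zero => intro y; simp
    | succ n ih =>
      intro y
      have e1 : (F y).val (n + 1) = (F (S₁.shiftMap y)).val n := by rw [heq]; rfl
      rw [e1, ih]
      have e2 : (⟨fun i => (S₁.shiftMap y).val (i + n), (S₁.mem_shift _ _).1 (S₁.shiftMap y).prop⟩ :
          {a // a ∈ S₁.carrier}) =
          ⟨fun i => y.val (i + (n + 1)), (S₁.mem_shift _ _).1 y.prop⟩ := by
        apply Subtype.ext; funext i; simp only [Subshift.shiftMap]; ring_nf
      rw [e2]
    | pred n ih =>
      intro y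
      obtain ⟨u, rfl⟩ : ∃ u, y = S₁.shiftMap u := by
        refine ⟨⟨fun i => y.val (i + -1), (S₁.mem_shift _ _).1 y.prop⟩, ?_⟩
        apply Subtype.ext; funext i; simp [Subshift.shiftMap]
      have e1 : (F (S₁.shiftMap u)).val (-n - 1) = (F u).val (-n) := by
        rw [heq]; simp [Subshift.shiftMap]
      rw [e1, ih]
      have e2 : (⟨fun i => (S₁.shiftMap u).val (i + (-n - 1)),
          (S₁.mem_shift _ _).1 (S₁.shiftMap u).prop⟩ : {a // a ∈ S₁.carrier}) =
          ⟨fun i => u.val (i + (-n)), (S₁.mem_shift _ _).1 u.prop⟩ := by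
        apply Subtype.ext; funext i; simp only [Subshift.shiftMap]; ring_nf
      rw [e2]
  refine ⟨r, fun r' hr' y z j h => ?_⟩
  rw [sh j y, sh j z]
  apply h0
  intro i h1 h2
  exact h (i + j) (by omega) (by omega)

theorem exists_lconj {A₁ A₂ : Type} [Fintype A₁] [Fintype A₂]
    (S₁ : Subshift A₁) (S₂ : Subshift A₂) (hΛ : Conjugacy S₁ S₂) :
    ∃ c : LConj S₁ S₂, c.F = hΛ.toFun := by
  obtain ⟨r₁, h₁⟩ := exists_radius S₁ S₂ hΛ.toFun hΛ.continuous_toFun hΛ.equivariant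
  have heq : ∀ b, hΛ.invFun (S₂.shiftMap b) = S₁.shiftMap (hΛ.invFun b) := by
    intro b
    rw [← hΛ.left_inv (S₁.shiftMap (hΛ.invFun b)), hΛ.equivariant, hΛ.right_inv]
  obtain ⟨r₂, h₂⟩ := exists_radius S₂ S₁ hΛ.invFun hΛ.continuous_invFun heq
  exact ⟨⟨hΛ.toFun, hΛ.invFun, hΛ.left_inv, hΛ.right_inv, max r₁ r₂,
    h₁ _ (le_max_left _ _), h₂ _ (le_max_right _ _)⟩, rfl⟩

/-- If two subshifts `Λ₁, Λ₂` are topologically conjugate via `h_Λ`, there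
is a homeomorphism `h : X_{Λ₁} → X_{Λ₂}` of the configuration spaces of their canonical
λ-graph bisystems such that (i) `h_Λ ∘ π₁ = π₂ ∘ h`; (ii) `h ∘ σ_{X_{Λ₁}} = σ_{X_{Λ₂}} ∘ h`;
(iii) `(h × h)(R_{Λ₁}) = R_{Λ₂}`; (iv) `h × h : R_{Λ₁} → R_{Λ₂}` is a homeomorphism for
the inductive limit topologies. -/
theorem conjugacy_induces_config_homeomorphism {A₁ A₂ : Type} [Fintype A₁] [Fintype A₂]
    (S₁ : Subshift A₁) (S₂ : Subshift A₂) (hΛ : Conjugacy S₁ S₂) :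
    ∃ h : Config (canonicalLGBS S₁) → Config (canonicalLGBS S₂),
      IsHomeomorph h ∧
      (∀ x : Config (canonicalLGBS S₁), ∃ hx : configSeq x ∈ S₁.carrier,
        (hΛ.toFun ⟨configSeq x, hx⟩).val = configSeq (h x)) ∧
      (∀ x : Config (canonicalLGBS S₁),
        h (shiftBy (canonicalLGBS S₁) 1 x) = shiftBy (canonicalLGBS S₂) 1 (h x)) ∧
      Prod.map h h '' Rset (canonicalLGBS S₁) = Rset (canonicalLGBS S₂) ∧
      ∃ H : ↥(Rset (canonicalLGBS S₁)) → ↥(Rset (canonicalLGBS S₂)),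
        (∀ y, (H y).val = (h y.val.1, h y.val.2)) ∧
        @IsHomeomorph _ _ (indTop (canonicalLGBS S₁)) (indTop (canonicalLGBS S₂)) H := by
  obtain ⟨c, hc⟩ := exists_lconj S₁ S₂ hΛ
  refine ⟨c.hmap, ?_, ?_, ?_, ?_, c.hR, fun _ => rfl, ?_⟩
  · exact isHomeomorph_iff_exists_inverse.2 ⟨c.continuous_hmap, c.symm.hmap, c.symm_hmap,
      c.symm.symm_hmap, c.symm.continuous_hmap⟩
  · intro x
    refine ⟨configSeq_mem x, ?_⟩
    rw [← hc]
    rfl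
  · exact c.hmap_shift (by rw [hc]; exact hΛ.equivariant)
  · ext ⟨a, b⟩
    constructor
    · rintro ⟨y, hy, hab⟩
      rw [← hab]
      exact (c.hR ⟨y, hy⟩).prop
    · intro hab
      exact ⟨_, (c.symm.hR ⟨(a, b), hab⟩).prop,
        Prod.ext (c.symm.symm_hmap a) (c.symm.symm_hmap b)⟩
  · let _ := indTop (canonicalLGBS S₁)
    let _ := indTop (canonicalLGBS S₂)
    exact isHomeomorph_iff_exists_inverse.2 ⟨c.continuous_hR, c.symm.hR, c.symm_hR,
      c.symm.symm_hR, c.symm.continuous_hR⟩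
end
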